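/- arXiv:1206.3152 — 3 statements merged into one kernel-verified Lean document; each statement's English description precedes it below -/
import Mathlib

section
/- For every real number α with 1 < α < 2 there exist constants ε > 0 and d₀ such that for all integers d ≥ d₀, all a ≤ α^d and all g, b, h: |H(a,g,b,h)| ≤ 2^{d−1}·2^{g − b − ε·g/log₂ d}. -/
/-- Two vertices of the Hamming cube `{0,1}^d` are adjacent iff they differ in
exactly one coordinate. -/
def cubeAdj (d : ℕ) (u v : Fin d → Bool) : Prop :=
  (Finset.univ.filter fun i => u i ≠ v i).card = 1

/-- The even vertices of the Hamming cube. -/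
def evenV (d : ℕ) : Set (Fin d → Bool) :=
  {v | Even (Finset.univ.filter fun i => v i = true).card}

/-- The odd vertices of the Hamming cube. -/
def oddV (d : ℕ) : Set (Fin d → Bool) :=
  {v | ¬ Even (Finset.univ.filter fun i => v i = true).card}

/-- `nbhd d A` is the set of vertices having at least one neighbour in `A`. -/
def nbhd (d : ℕ) (A : Set (Fin d → Bool)) : Set (Fin d → Bool) :=
  {v | ∃ u ∈ A, cubeAdj d u v}

/-- `bset d A` is the set of vertices all of whose neighbours lie in `A`. -/
def bset (d : ℕ) (A : Set (Fin d → Bool)) : Set (Fin d → Bool) :=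
  {v | ∀ u, cubeAdj d v u → u ∈ A}

/-- Graph (Hamming) distance in the cube `Q_d`. -/
def hamDist {d : ℕ} (u v : Fin d → Bool) : ℕ :=
  (Finset.univ.filter fun i => u i ≠ v i).card

/-- `A` is 2-linked: any two of its vertices are connected by a chain of steps,
inside `A`, of Hamming distance at most 2 each. -/
def twoLinked {d : ℕ} (A : Set (Fin d → Bool)) : Prop :=
  ∀ u ∈ A, ∀ v ∈ A, Relation.ReflTransGen (fun x y => y ∈ A ∧ hamDist x y ≤ 2) u v

/-- The family of 2-linked subsets `A ⊆ E` with `|A| = a`, `|N(A)| = g`,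
`|B(A)| = b` and `|N(B(A))| = h`. -/
def Hfam (d a g b h : ℕ) : Set (Set (Fin d → Bool)) :=
  {A | A ⊆ evenV d ∧ twoLinked A ∧ A.ncard = a ∧ (nbhd d A).ncard = g ∧
       (bset d A).ncard = b ∧ (nbhd d (bset d A)).ncard = h}

section

open Finset

namespace HammingCube

variable {d : ℕ}

/-- The vertex obtained from `u` by switching its `i`-th coordinate. -/
def flip (i : Fin d) (u : Fin d → Bool) : Fin d → Bool :=
  Function.update u i (!u i)

@[simp]
theorem flip_same (i : Fin d) (u : Fin d → Bool) : flip i u i = !u i := by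
  simp [flip]

theorem flip_of_ne {i j : Fin d} (h : j ≠ i) (u : Fin d → Bool) : flip i u j = u j := by
  simp [flip, h]

theorem cubeAdj_iff_exists_flip {u v : Fin d → Bool} :
    cubeAdj d u v ↔ ∃ i, flip i u = v := by
  unfold cubeAdj
  rw [card_eq_one]
  refine exists_congr fun i => ⟨fun h => ?_, ?_⟩
  · funext j
    have hj := Finset.ext_iff.1 h j
    by_cases hji : j = i
    · subst hji
      have : u j ≠ v j := by simpa using hj
      rw [flip_same]
      cases hu : u j <;> cases hv : v j <;> simp_all
    · rw [flip_of_ne hji]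
      simpa [hji] using hj
  · rintro rfl
    ext j
    by_cases hji : j = i
    · subst hji; simp
    · simp [flip_of_ne hji, hji]

theorem cubeAdj_comm {u v : Fin d → Bool} : cubeAdj d u v ↔ cubeAdj d v u := by
  simp [cubeAdj, ne_comm]

theorem flip_mem_evenV (i : Fin d) (u : Fin d → Bool) : flip i u ∈ evenV d ↔ u ∉ evenV d := by
  unfold evenV
  simp only [Set.mem_ofPred_eq]
  cases hu : u i
  · have : (univ.filter fun j => flip i u j = true) =
        insert i (univ.filter fun j => u j = true) := by
      ext j
      by_cases hji : j = i
      · subst hji; simp [hu]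
      · simp [flip_of_ne hji, hji]
    rw [this, card_insert_of_notMem (by simp [hu]), Nat.even_add_one]
  · have : (univ.filter fun j => u j = true) =
        insert i (univ.filter fun j => flip i u j = true) := by
      ext j
      by_cases hji : j = i
      · subst hji; simp [hu]
      · simp [flip_of_ne hji, hji]
    rw [this, card_insert_of_notMem (by simp [hu]), Nat.even_add_one, not_not]

theorem mem_evenV_iff_of_cubeAdj {u v : Fin d → Bool} (h : cubeAdj d u v) :
    v ∈ evenV d ↔ u ∉ evenV d := by
  obtain ⟨i, rfl⟩ := cubeAdj_iff_exists_flip.1 h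
  exact flip_mem_evenV i u

/-- The finset of neighbours of a vertex of the cube. -/
def nbrs (u : Fin d → Bool) : Finset (Fin d → Bool) :=
  univ.image fun i => flip i u

theorem mem_nbrs {u v : Fin d → Bool} : v ∈ nbrs u ↔ cubeAdj d u v := by
  simp [nbrs, cubeAdj_iff_exists_flip]

theorem mem_nbrs_comm {u v : Fin d → Bool} : v ∈ nbrs u ↔ u ∈ nbrs v := by
  rw [mem_nbrs, mem_nbrs, cubeAdj_comm]

theorem card_nbrs (u : Fin d → Bool) : #(nbrs u) = d := by
  rw [nbrs, card_image_of_injective, card_univ, Fintype.card_fin]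
  intro i j hij
  by_contra hne
  have := congrFun hij i
  simp [flip_of_ne hne] at this

theorem notMem_nbrs_self (u : Fin d → Bool) : u ∉ nbrs u := by
  simp [mem_nbrs, cubeAdj]

/-- The number of pairs of adjacent vertices in `X × Y`. -/
def crossCount (X Y : Finset (Fin d → Bool)) : ℕ :=
  ∑ x ∈ X, #(nbrs x ∩ Y)

theorem crossCount_comm (X Y : Finset (Fin d → Bool)) : crossCount X Y = crossCount Y X := by
  have key : ∀ X Y : Finset (Fin d → Bool),
      crossCount X Y = ∑ x ∈ X, ∑ y ∈ Y, if y ∈ nbrs x then 1 else 0 := by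
    intro X Y
    refine sum_congr rfl fun x _ => ?_
    rw [inter_comm, ← filter_mem_eq_inter, card_filter]
  rw [key, key, sum_comm]
  simp only [mem_nbrs_comm]

theorem crossCount_union_left {X Y : Finset (Fin d → Bool)} (h : Disjoint X Y)
    (Z : Finset (Fin d → Bool)) :
    crossCount (X ∪ Y) Z = crossCount X Z + crossCount Y Z :=
  sum_union h

theorem crossCount_union_self {X Y : Finset (Fin d → Bool)} (h : Disjoint X Y) :
    crossCount (X ∪ Y) (X ∪ Y) = crossCount X X + crossCount Y Y + 2 * crossCount X Y := by
  rw [crossCount_union_left h, crossCount_comm X (X ∪ Y), crossCount_comm Y (X ∪ Y),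
    crossCount_union_left h, crossCount_union_left h, crossCount_comm Y X]
  ring

theorem crossCount_le_of_separated (j : Fin d) {X Y : Finset (Fin d → Bool)}
    (h : ∀ x ∈ X, ∀ y ∈ Y, x j ≠ y j) : crossCount X Y ≤ #X := by
  rw [card_eq_sum_ones]
  refine sum_le_sum fun x hx => ?_
  rw [card_le_one_iff_subset_singleton]
  refine ⟨flip j x, fun y hy => ?_⟩
  rw [mem_inter, mem_nbrs, cubeAdj_iff_exists_flip] at hy
  obtain ⟨⟨i, rfl⟩, hy⟩ := hy
  have hij : j = i := by
    by_contra hne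
    exact h x hx _ hy (flip_of_ne hne x).symm
  simp [hij]

theorem mul_logb_add_mul_logb_add_le {x y : ℝ} (hx : 0 < x) (hxy : x ≤ y) :
    x * Real.logb 2 x + y * Real.logb 2 y + 2 * x ≤ (x + y) * Real.logb 2 (x + y) := by
  have hy : 0 < y := hx.trans_le hxy
  have h1 : 1 + Real.logb 2 x ≤ Real.logb 2 (x + y) := by
    rw [← Real.logb_self_eq_one (b := 2) (by norm_num), ← Real.logb_mul (by norm_num) hx.ne']
    exact Real.logb_le_logb_of_le (by norm_num) (by positivity) (by linarith)
  have h2 : x ≤ y * (Real.logb 2 (x + y) - Real.logb 2 y) := by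
    have hb : (2 : ℝ) ≤ (1 + x / y) ^ (y / x) := by
      have := one_add_mul_self_le_rpow_one_add (s := x / y) (p := y / x)
        (by linarith [div_pos hx hy]) ((one_le_div hx).2 hxy)
      have e : y / x * (x / y) = 1 := by field_simp
      linarith
    have hl := Real.logb_le_logb_of_le (b := 2) (by norm_num) (by norm_num) hb
    rw [Real.logb_self_eq_one (by norm_num), Real.logb_rpow_eq_mul_logb_of_pos (by positivity),
      show 1 + x / y = (x + y) / y by field_simp; ring,
      Real.logb_div (by positivity) hy.ne', div_mul_eq_mul_div, le_div_iff₀ hx] at hl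
    linarith
  nlinarith

/-- The edge-isoperimetric inequality in the cube. -/
theorem crossCount_self_le (W : Finset (Fin d → Bool)) :
    (crossCount W W : ℝ) ≤ #W * Real.logb 2 #W := by
  induction hn : #W using Nat.strong_induction_on generalizing W with
  | _ n ih =>
    subst hn
    rcases le_or_gt #W 1 with h1 | h1
    · have h0 : crossCount W W = 0 := by
        refine sum_eq_zero fun x hx => ?_
        rw [card_eq_zero, ← disjoint_iff_inter_eq_empty, disjoint_left]
        intro y hy hyW
        rw [card_le_one.1 h1 y hyW x hx] at hy
        exact notMem_nbrs_self x hy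
      rw [h0]
      have : Real.logb 2 #W = 0 := by
        interval_cases #W <;> simp
      simp [this]
    · obtain ⟨x, hx, y, hy, hxy⟩ := one_lt_card.1 h1
      obtain ⟨j, hj⟩ := Function.ne_iff.1 hxy
      set X := W.filter fun z => z j = x j with hX
      set Y := W.filter fun z => ¬ z j = x j with hY
      have hdis : Disjoint X Y := disjoint_filter_filter_not _ _ _
      have hun : X ∪ Y = W := filter_union_filter_not_eq _ _
      have hcard : #X + #Y = #W := by rw [← hun, card_union_of_disjoint hdis]
      have hXpos : 0 < #X := card_pos.2 ⟨x, by simp [hX, hx]⟩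
      have hYpos : 0 < #Y := card_pos.2 ⟨y, by simp [hY, hy, Ne.symm hj]⟩
      have hsep : ∀ u ∈ X, ∀ v ∈ Y, u j ≠ v j := by
        intro u hu v hv h
        rw [hX, mem_filter] at hu
        rw [hY, mem_filter] at hv
        exact hv.2 (h.symm.trans hu.2)
      have e := crossCount_union_self hdis
      rw [hun] at e
      have cX := crossCount_le_of_separated j hsep
      have cY := crossCount_le_of_separated j (fun u hu v hv => (hsep v hv u hu).symm)
      rw [crossCount_comm] at cY
      have iX := ih #X (by omega) X rfl
      have iY := ih #Y (by omega) Y rfl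
      have cX' : (crossCount X Y : ℝ) ≤ #X := by exact_mod_cast cX
      have cY' : (crossCount X Y : ℝ) ≤ #Y := by exact_mod_cast cY
      have hXpos' : (0 : ℝ) < #X := by exact_mod_cast hXpos
      have hYpos' : (0 : ℝ) < #Y := by exact_mod_cast hYpos
      rw [e, ← hcard]
      push_cast
      rcases le_total (#X : ℝ) #Y with hle | hle
      · have := mul_logb_add_mul_logb_add_le hXpos' hle
        linarith
      · have := mul_logb_add_mul_logb_add_le hYpos' hle
        rw [add_comm (#Y : ℝ)] at this
        linarith

theorem card_le_mul_card_of_nbrs {X F : Finset (Fin d → Bool)} {c : ℝ} (hd : 0 < d)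
    (hc : 0 ≤ c) (hdis : Disjoint X F)
    (hdeg : ∀ u ∈ X, (1 + c) / 2 * d ≤ #(nbrs u ∩ F))
    (hsize : (#X + #F : ℝ) ≤ 2 ^ (c * d)) : (#X : ℝ) ≤ c * #F := by
  rcases X.eq_empty_or_nonempty with rfl | hne
  · simp; positivity
  have hXpos : (0 : ℝ) < #X := by exact_mod_cast hne.card_pos
  have hd' : (0 : ℝ) < d := by exact_mod_cast hd
  have h1 : #X * ((1 + c) / 2 * d) ≤ (crossCount X F : ℝ) := by
    unfold crossCount
    push_cast
    rw [← nsmul_eq_mul]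
    exact card_nsmul_le_sum _ _ _ hdeg
  have h2 := crossCount_self_le (X ∪ F)
  rw [crossCount_union_self hdis, card_union_of_disjoint hdis] at h2
  push_cast at h2
  have h3 : Real.logb 2 (#X + #F : ℝ) ≤ c * d := by
    rw [Real.logb_le_iff_le_rpow (by norm_num) (by positivity)]
    exact hsize
  have h4 : (#X + #F : ℝ) * Real.logb 2 (#X + #F : ℝ) ≤ (#X + #F) * (c * d) := by gcongr
  have h5 : (0 : ℝ) ≤ crossCount X X := by positivity
  have h6 : (0 : ℝ) ≤ crossCount F F := by positivity
  have h7 : (#X : ℝ) * d ≤ c * #F * d := by linarith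
  exact le_of_mul_le_mul_right h7 hd'

/-- The neighbourhood of a finite set of vertices, as a finset. -/
def finNbhd (T : Finset (Fin d → Bool)) : Finset (Fin d → Bool) :=
  T.biUnion nbrs

theorem mem_finNbhd {T : Finset (Fin d → Bool)} {v : Fin d → Bool} :
    v ∈ finNbhd T ↔ ∃ u ∈ T, cubeAdj d u v := by
  simp [finNbhd, mem_nbrs]

theorem coe_finNbhd (T : Finset (Fin d → Bool)) :
    (finNbhd T : Set (Fin d → Bool)) = nbhd d T := by
  ext v
  simp [mem_finNbhd, nbhd]

theorem finNbhd_mono {S T : Finset (Fin d → Bool)} (h : S ⊆ T) : finNbhd S ⊆ finNbhd T :=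
  biUnion_subset_biUnion_of_subset_left _ h

theorem card_finNbhd_le (T : Finset (Fin d → Bool)) : #(finNbhd T) ≤ #T * d :=
  card_biUnion_le_card_mul _ _ _ fun u _ => (card_nbrs u).le

/-- A greedy choice of few vertices of `X` whose neighbourhoods contain most of the
neighbourhood of each vertex of `X`. -/
theorem exists_greedy_cover (X : Finset (Fin d → Bool)) {q : ℝ} (hq : 0 ≤ q) :
    ∃ T ⊆ X, q * #T ≤ #(finNbhd T) ∧ ∀ u ∈ X, (d : ℝ) - q ≤ #(nbrs u ∩ finNbhd T) := by
  classical
  obtain ⟨T, hT, hmax⟩ := (X.powerset.filter fun T => q * #T ≤ #(finNbhd T)).exists_max_image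
    card ⟨∅, by simp⟩
  rw [mem_filter, mem_powerset] at hT
  refine ⟨T, hT.1, hT.2, fun u hu => ?_⟩
  by_contra! hlt
  have hsum := card_sdiff_add_card_inter (nbrs u) (finNbhd T)
  rw [card_nbrs] at hsum
  have hsum' : (#(nbrs u \ finNbhd T) : ℝ) + #(nbrs u ∩ finNbhd T) = d := by
    exact_mod_cast hsum
  have huT : u ∉ T := by
    intro huT
    have : nbrs u \ finNbhd T = ∅ := sdiff_eq_empty_iff_subset.2 (subset_biUnion_of_mem _ huT)
    rw [this] at hsum'
    rw [card_empty, Nat.cast_zero, zero_add] at hsum'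
    linarith
  have hins : finNbhd (insert u T) = (nbrs u \ finNbhd T) ∪ finNbhd T := by
    rw [sdiff_union_self_eq_union, finNbhd, biUnion_insert, finNbhd]
  have := hmax (insert u T) (by
    rw [mem_filter, mem_powerset]
    refine ⟨insert_subset hu hT.1, ?_⟩
    rw [hins, card_union_of_disjoint sdiff_disjoint, card_insert_of_notMem huT]
    push_cast
    linarith [hT.2])
  rw [card_insert_of_notMem huT] at this
  omega

/-- The lists `L` of length `n` for which `v :: L` is a chain of the relation `R`. -/
noncomputable def walksFrom {β : Type*} [Fintype β] [DecidableEq β] (R : β → β → Prop)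
    [DecidableRel R] : ℕ → β → Finset (List β)
  | 0, _ => {[]}
  | n + 1, v => (univ.filter (R v)).biUnion fun y => (walksFrom R n y).image (List.cons y)

theorem mem_walksFrom {β : Type*} [Fintype β] [DecidableEq β] {R : β → β → Prop}
    [DecidableRel R] {v : β} {L : List β} (h : (v :: L).IsChain R) :
    L ∈ walksFrom R L.length v := by
  induction L generalizing v with
  | nil => simp [walksFrom]
  | cons y L ih =>
    rw [List.isChain_cons_cons] at h
    rw [List.length_cons, walksFrom, mem_biUnion]
    exact ⟨y, by simpa using h.1, mem_image_of_mem _ (ih h.2)⟩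

theorem card_walksFrom_le {β : Type*} [Fintype β] [DecidableEq β] {R : β → β → Prop}
    [DecidableRel R] {D : ℕ} (hD : ∀ x, #(univ.filter (R x)) ≤ D) (n : ℕ) (v : β) :
    #(walksFrom R n v) ≤ D ^ n := by
  induction n generalizing v with
  | zero => simp [walksFrom]
  | succ n ih =>
    rw [walksFrom, pow_succ']
    exact (card_biUnion_le_card_mul _ _ _ fun y _ => card_image_le.trans (ih y)).trans
      (Nat.mul_le_mul_right _ (hD v))

theorem exists_isChain_insert {β : Type*} {R : β → β → Prop} (hsymm : ∀ x y, R x y → R y x)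
    {x y : β} (hxy : R x y) {v : β} {L : List β} (hL : (v :: L).IsChain R) (hx : x ∈ v :: L) :
    ∃ L' : List β, (v :: L').IsChain R ∧ L'.length = L.length + 2 ∧
      ∀ z, z ∈ v :: L' ↔ z = y ∨ z ∈ v :: L := by
  induction L generalizing v with
  | nil =>
    have hxv : x = v := by simpa using hx
    subst hxv
    refine ⟨[y, x], by simp [hxy, hsymm _ _ hxy], by simp, fun z => ?_⟩
    simp only [List.mem_cons, List.not_mem_nil, or_false]
    tauto
  | cons w L ih =>
    by_cases hxv : x = v
    · subst hxv
      refine ⟨y :: x :: w :: L, ?_, by simp, fun z => ?_⟩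
      · rw [List.isChain_cons_cons, List.isChain_cons_cons]
        exact ⟨hxy, hsymm _ _ hxy, hL⟩
      · simp only [List.mem_cons]
        tauto
    · rw [List.isChain_cons_cons] at hL
      obtain ⟨L', h1, h2, h3⟩ := ih hL.2 ((List.mem_cons.1 hx).resolve_left hxv)
      refine ⟨w :: L', List.isChain_cons_cons.2 ⟨hL.1, h1⟩, by simp [h2], fun z => ?_⟩
      rw [List.mem_cons, h3, List.mem_cons (l := w :: L)]
      tauto

/-- A connected finite set is the support of a walk of any prescribed length which is at least
twice its cardinality. -/
theorem exists_isChain_support {β : Type*} [DecidableEq β] {R : β → β → Prop}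
    (hrefl : ∀ x, R x x) (hsymm : ∀ x y, R x y → R y x) {U : Finset β} {v : β} (hv : v ∈ U)
    (hconn : ∀ W ⊂ U, v ∈ W → ∃ x ∈ W, ∃ y ∈ U \ W, R x y) {n : ℕ} (hn : 2 * #U ≤ n) :
    ∃ L : List β, (v :: L).IsChain R ∧ L.length = n ∧ (v :: L).toFinset = U := by
  have key : ∀ k, k + 1 ≤ #U → ∃ L : List β, (v :: L).IsChain R ∧ L.length = 2 * k ∧
      (v :: L).toFinset ⊆ U ∧ #(v :: L).toFinset = k + 1 := by
    intro k
    induction k with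
    | zero => exact fun _ => ⟨[], by simp, by simp, by simpa using hv, by simp⟩
    | succ k ih =>
      intro hk
      obtain ⟨L, h1, h2, h3, h4⟩ := ih (by omega)
      obtain ⟨x, hx, y, hy, hxy⟩ := hconn (v :: L).toFinset
        (ssubset_of_subset_of_ne h3 fun h => by rw [h] at h4; omega) (by simp)
      rw [mem_sdiff] at hy
      obtain ⟨L', g1, g2, g3⟩ := exists_isChain_insert hsymm hxy h1 (List.mem_toFinset.1 hx)
      have hL' : (v :: L').toFinset = insert y (v :: L).toFinset := by
        ext z
        rw [List.mem_toFinset, g3, mem_insert, List.mem_toFinset]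
      refine ⟨L', g1, by omega, ?_, ?_⟩
      · rw [hL']
        exact insert_subset hy.1 h3
      · rw [hL', card_insert_of_notMem hy.2, h4]
  have hpos : 0 < #U := card_pos.2 ⟨v, hv⟩
  obtain ⟨L, h1, h2, h3, h4⟩ := key (#U - 1) (by omega)
  have hU : (v :: L).toFinset = U := eq_of_subset_of_card_le h3 (by omega)
  have pad : ∀ m, ∃ L' : List β, (v :: L').IsChain R ∧ L'.length = L.length + m ∧
      (v :: L').toFinset = U := by
    intro m
    induction m with
    | zero => exact ⟨L, h1, rfl, hU⟩
    | succ m ih =>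
      obtain ⟨L', g1, g2, g3⟩ := ih
      refine ⟨v :: L', List.isChain_cons_cons.2 ⟨hrefl v, g1⟩, by simp [g2]; ring, ?_⟩
      rw [List.toFinset_cons, g3, insert_eq_of_mem hv]
  obtain ⟨L', g1, g2, g3⟩ := pad (n - L.length)
  exact ⟨L', g1, by omega, g3⟩

theorem hamDist_comm (u v : Fin d → Bool) : hamDist u v = hamDist v u :=
  hammingDist_comm u v

theorem hamDist_self (u : Fin d → Bool) : hamDist u u = 0 :=
  hammingDist_self u

theorem hamDist_triangle (u v w : Fin d → Bool) : hamDist u w ≤ hamDist u v + hamDist v w :=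
  hammingDist_triangle u v w

theorem hamDist_of_cubeAdj {u v : Fin d → Bool} (h : cubeAdj d u v) : hamDist u v = 1 :=
  h

theorem card_hamDist_le (hd : 0 < d) (k : ℕ) (u : Fin d → Bool) :
    #(univ.filter fun v => hamDist u v ≤ k) ≤ (k + 1) * d ^ k := by
  have hinj : Function.Injective fun v : Fin d → Bool => univ.filter fun i => u i ≠ v i := by
    intro v w h
    funext i
    have := Finset.ext_iff.1 h i
    simp only [mem_filter, mem_univ, true_and] at this
    cases hu : u i <;> cases hv : v i <;> cases hw : w i <;> simp_all
  rw [← card_image_of_injective _ hinj]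
  have hsub : (univ.filter fun v => hamDist u v ≤ k).image
      (fun v : Fin d → Bool => univ.filter fun i => u i ≠ v i) ⊆
        (range (k + 1)).biUnion fun j => powersetCard j univ := by
    intro s hs
    obtain ⟨v, hv, rfl⟩ := mem_image.1 hs
    rw [mem_biUnion]
    exact ⟨hamDist u v, mem_range.2 (Nat.lt_succ_of_le (mem_filter.1 hv).2),
      mem_powersetCard.2 ⟨subset_univ _, rfl⟩⟩
  refine (card_le_card hsub).trans ?_
  refine (card_biUnion_le_card_mul _ _ (d ^ k) fun j hj => ?_).trans (by simp)
  rw [card_powersetCard, card_univ, Fintype.card_fin]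
  exact (Nat.choose_le_pow d j).trans (Nat.pow_le_pow_right hd (by simpa [Nat.lt_succ_iff] using hj))

open Classical in
theorem card_evenV_le (hd : 0 < d) : #(univ.filter fun v => v ∈ evenV d) ≤ 2 ^ (d - 1) := by
  have h1 : #(univ.filter fun v => v ∈ evenV d) ≤ #(univ.filter fun v => ¬ v ∈ evenV d) := by
    refine card_le_card_of_injOn (flip ⟨0, hd⟩) (fun v hv => ?_) fun v _ w _ h => ?_
    · simpa [flip_mem_evenV] using hv
    · have h' := congrArg (flip ⟨0, hd⟩) h
      simpa [flip] using h'
  have h2 := card_filter_add_card_filter_not (s := (univ : Finset (Fin d → Bool)))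
    (fun v => v ∈ evenV d)
  rw [card_univ, Fintype.card_fun, Fintype.card_bool, Fintype.card_fin] at h2
  have h3 : 2 ^ d = 2 * 2 ^ (d - 1) := by
    rw [← pow_succ', Nat.sub_add_cancel hd]
  omega

/-- A set `U` which contains a net of a 2-linked set `A` and otherwise consists of vertices
close to that net is connected by steps of length at most 6. -/
theorem exists_crossing_of_twoLinked {A : Set (Fin d → Bool)} (hA : twoLinked A)
    {T U : Finset (Fin d → Bool)} (hTA : ∀ t ∈ T, t ∈ A) (hTU : T ⊆ U)
    (hnet : ∀ u ∈ A, ∃ t ∈ T, hamDist u t ≤ 2) (hU : ∀ u ∈ U, ∃ t ∈ T, hamDist u t ≤ 6)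
    {v : Fin d → Bool} (hv : v ∈ T) {W : Finset (Fin d → Bool)} (hW : W ⊂ U) (hvW : v ∈ W) :
    ∃ x ∈ W, ∃ y ∈ U \ W, hamDist x y ≤ 6 := by
  by_contra! hno
  have hclosed : ∀ x ∈ W, ∀ y ∈ U, hamDist x y ≤ 6 → y ∈ W := by
    intro x hx y hy hxy
    by_contra hyW
    exact absurd (hno x hx y (mem_sdiff.2 ⟨hy, hyW⟩)) (by omega)
  have hreach : ∀ z, Relation.ReflTransGen (fun x y => y ∈ A ∧ hamDist x y ≤ 2) v z →
      ∃ t ∈ T, t ∈ W ∧ hamDist z t ≤ 2 := by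
    intro z hz
    induction hz with
    | refl => exact ⟨v, hv, hvW, by simp [hamDist_self]⟩
    | @tail y z _ hyz ih =>
      obtain ⟨t, ht, htW, hyt⟩ := ih
      obtain ⟨s, hs, hzs⟩ := hnet z hyz.1
      have h1 := hamDist_triangle t y s
      have h2 := hamDist_triangle y z s
      rw [hamDist_comm t y] at h1
      exact ⟨s, hs, hclosed t htW s (hTU hs) (by omega), hzs⟩
  have hTW : ∀ t ∈ T, t ∈ W := by
    intro t ht
    obtain ⟨s, -, hsW, hts⟩ := hreach t (hA v (hTA v hv) t (hTA t ht))
    rw [hamDist_comm] at hts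
    exact hclosed s hsW t (hTU ht) (by omega)
  refine hW.2 fun y hy => ?_
  obtain ⟨t, ht, hyt⟩ := hU y hy
  rw [hamDist_comm] at hyt
  exact hclosed t (hTW t ht) y hy hyt

open Classical in
/-- The even vertices in `U`. -/
noncomputable def evenPart (U : Finset (Fin d → Bool)) : Finset (Fin d → Bool) :=
  U.filter fun v => v ∈ evenV d

open Classical in
/-- The odd vertices in `U`. -/
noncomputable def oddPart (U : Finset (Fin d → Bool)) : Finset (Fin d → Bool) :=
  U.filter fun v => v ∉ evenV d

/-- The set of even vertices adjacent to odd vertices of `U`. -/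
noncomputable def lowerApprox (U : Finset (Fin d → Bool)) : Finset (Fin d → Bool) :=
  finNbhd (oddPart U)

open Classical in
/-- The set of even vertices most of whose neighbours are adjacent to even vertices of `U`. -/
noncomputable def upperApprox (c : ℝ) (U : Finset (Fin d → Bool)) : Finset (Fin d → Bool) :=
  univ.filter fun u => u ∈ evenV d ∧ (1 + c) / 2 * d ≤ #(nbrs u ∩ finNbhd (evenPart U))

theorem mem_upperApprox {c : ℝ} {U : Finset (Fin d → Bool)} {u : Fin d → Bool} :
    u ∈ upperApprox c U ↔
      u ∈ evenV d ∧ (1 + c) / 2 * d ≤ #(nbrs u ∩ finNbhd (evenPart U)) := by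
  simp [upperApprox]

theorem card_upperApprox_le_two_mul {c : ℝ} (hc : 0 ≤ c) (hd : 0 < d)
    (U : Finset (Fin d → Bool)) :
    (#(upperApprox c U) : ℝ) ≤ 2 * #(finNbhd (evenPart U)) := by
  set S := upperApprox c U with hS
  set F := finNbhd (evenPart U) with hF
  have hd' : (0 : ℝ) < d := by exact_mod_cast hd
  have h1 : #S * ((1 + c) / 2 * d) ≤ (crossCount S F : ℝ) := by
    unfold crossCount
    push_cast
    rw [← nsmul_eq_mul]
    exact card_nsmul_le_sum _ _ _ fun u hu => (mem_upperApprox.1 hu).2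
  have h2 : crossCount F S ≤ #F * d := by
    refine sum_le_card_nsmul _ _ _ fun u _ => ?_
    exact (card_le_card inter_subset_left).trans (card_nbrs u).le
  rw [crossCount_comm] at h2
  have h2' : (crossCount S F : ℝ) ≤ #F * d := by exact_mod_cast h2
  have h3 : 0 ≤ #S * (c * d) := by positivity
  refine le_of_mul_le_mul_right (a := (d : ℝ)) ?_ hd'
  linarith

theorem finNbhd_disjoint_of_even {X T : Finset (Fin d → Bool)} (hX : ∀ u ∈ X, u ∈ evenV d)
    (hT : ∀ u ∈ T, u ∈ evenV d) : Disjoint X (finNbhd T) := by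
  rw [disjoint_left]
  intro u hu huT
  obtain ⟨t, ht, htu⟩ := mem_finNbhd.1 huT
  exact (mem_evenV_iff_of_cubeAdj htu).1 (hX u hu) (hT t ht)

theorem finNbhd_disjoint_of_odd {X T : Finset (Fin d → Bool)} (hX : ∀ u ∈ X, u ∉ evenV d)
    (hT : ∀ u ∈ T, u ∉ evenV d) : Disjoint X (finNbhd T) := by
  rw [disjoint_left]
  intro u hu huT
  obtain ⟨t, ht, htu⟩ := mem_finNbhd.1 huT
  exact hX u hu ((mem_evenV_iff_of_cubeAdj htu).2 (hT t ht))

/-- Every small 2-linked set `A` of even vertices lies between the two approximations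
determined by a suitable short walk. -/
theorem exists_approx {c : ℝ} (hc0 : 0 < c) (hc1 : c < 1) (hd : 0 < d)
    {A B : Finset (Fin d → Bool)} (hA : ∀ u ∈ A, u ∈ evenV d)
    (hlink : twoLinked (A : Set (Fin d → Bool))) (hne : A.Nonempty)
    (hB : ∀ v, v ∈ B ↔ ∀ u, cubeAdj d v u → u ∈ A)
    (hsize : 3 * (#(finNbhd A) : ℝ) ≤ 2 ^ (c * d)) {n : ℕ}
    (hn : ∀ m : ℕ, (1 - c) / 2 * d * m ≤ 4 * #(finNbhd A) → m ≤ n) :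
    ∃ v ∈ evenV d, ∃ L : List (Fin d → Bool),
      (v :: L).IsChain (fun x y => hamDist x y ≤ 6) ∧ L.length = n ∧
      lowerApprox (v :: L).toFinset ⊆ A ∧ A ⊆ upperApprox c (v :: L).toFinset ∧
      (#(upperApprox c (v :: L).toFinset) : ℝ) ≤ c * #(finNbhd A) ∧
      #B ≤ #(lowerApprox (v :: L).toFinset) := by
  have hd' : (0 : ℝ) < d := by exact_mod_cast hd
  have hq : 0 ≤ (1 - c) / 2 * d := mul_nonneg (by linarith) hd'.le
  have hdq : (d : ℝ) - (1 - c) / 2 * d = (1 + c) / 2 * d := by ring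
  have hpos : 0 < (1 + c) / 2 * (d : ℝ) := by positivity
  have exists_nbr : ∀ {u} {F : Finset (Fin d → Bool)}, (1 + c) / 2 * (d : ℝ) ≤ #(nbrs u ∩ F) →
      ∃ w ∈ F, cubeAdj d u w := by
    intro u F h
    have hcard : 0 < #(nbrs u ∩ F) := by exact_mod_cast hpos.trans_le h
    obtain ⟨w, hw⟩ := card_pos.1 hcard
    rw [mem_inter, mem_nbrs] at hw
    exact ⟨w, hw.2, hw.1⟩
  have hBadj : ∀ v ∈ B, ∃ u ∈ A, cubeAdj d v u := by
    intro v hv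
    have hadj : cubeAdj d v (flip ⟨0, hd⟩ v) := cubeAdj_iff_exists_flip.2 ⟨_, rfl⟩
    exact ⟨_, (hB v).1 hv _ hadj, hadj⟩
  have hBodd : ∀ v ∈ B, v ∉ evenV d := by
    intro v hv
    obtain ⟨u, hu, hvu⟩ := hBadj v hv
    exact (mem_evenV_iff_of_cubeAdj hvu).1 (hA u hu)
  obtain ⟨T, hTA, hTcard, hT⟩ := exists_greedy_cover A hq
  obtain ⟨T', hTB, hTcard', hT'⟩ := exists_greedy_cover B hq
  rw [hdq] at hT hT'
  have hTeven : ∀ t ∈ T, t ∈ evenV d := fun t ht => hA t (hTA ht)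
  have hTodd : ∀ t ∈ T', t ∉ evenV d := fun t ht => hBodd t (hTB ht)
  have heven : evenPart (T ∪ T') = T := by
    ext u
    simp only [evenPart, mem_filter, mem_union]
    exact ⟨fun h => h.1.resolve_right fun h' => hTodd u h' h.2, fun h => ⟨Or.inl h, hTeven u h⟩⟩
  have hodd : oddPart (T ∪ T') = T' := by
    ext u
    simp only [oddPart, mem_filter, mem_union]
    exact ⟨fun h => h.1.resolve_left fun h' => h.2 (hTeven u h'), fun h => ⟨Or.inr h, hTodd u h⟩⟩
  have hlower : lowerApprox (T ∪ T') ⊆ A := by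
    intro u hu
    rw [lowerApprox, hodd, mem_finNbhd] at hu
    obtain ⟨t, ht, htu⟩ := hu
    exact (hB t).1 (hTB ht) u htu
  have hupper : A ⊆ upperApprox c (T ∪ T') := by
    intro u hu
    rw [mem_upperApprox, heven]
    exact ⟨hA u hu, hT u hu⟩
  have hFle : (#(finNbhd T) : ℝ) ≤ #(finNbhd A) := by
    exact_mod_cast card_le_card (finNbhd_mono hTA)
  have hS2 := card_upperApprox_le_two_mul hc0.le hd (T ∪ T')
  rw [heven] at hS2
  have hSc : (#(upperApprox c (T ∪ T')) : ℝ) ≤ c * #(finNbhd T) := by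
    refine card_le_mul_card_of_nbrs hd hc0.le
      (finNbhd_disjoint_of_even (fun u hu => (mem_upperApprox.1 hu).1) hTeven) (fun u hu => ?_) ?_
    · have := (mem_upperApprox.1 hu).2
      rwa [heven] at this
    · linarith
  have hScA : (#(upperApprox c (T ∪ T')) : ℝ) ≤ c * #(finNbhd A) :=
    hSc.trans (by gcongr)
  have hAle : (#A : ℝ) ≤ #(finNbhd A) := by
    have h1 : (#A : ℝ) ≤ #(upperApprox c (T ∪ T')) := by exact_mod_cast card_le_card hupper
    have h2 : c * (#(finNbhd A) : ℝ) ≤ 1 * #(finNbhd A) := by gcongr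
    linarith
  have hlow : finNbhd T' ⊆ A := by
    rwa [lowerApprox, hodd] at hlower
  have hlowle : (#(finNbhd T') : ℝ) ≤ #A := by exact_mod_cast card_le_card hlow
  have hBN : (#B : ℝ) ≤ #(finNbhd A) := by
    refine mod_cast card_le_card fun v hv => ?_
    obtain ⟨u, hu, hvu⟩ := hBadj v hv
    exact mem_finNbhd.2 ⟨u, hu, cubeAdj_comm.1 hvu⟩
  have hBc : (#B : ℝ) ≤ c * #(finNbhd T') :=
    card_le_mul_card_of_nbrs hd hc0.le (finNbhd_disjoint_of_odd hBodd hTodd) hT' (by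
      have : (0 : ℝ) ≤ #(finNbhd A) := by positivity
      linarith)
  have hBle : #B ≤ #(lowerApprox (T ∪ T')) := by
    rw [lowerApprox, hodd]
    have : c * (#(finNbhd T') : ℝ) ≤ 1 * #(finNbhd T') := by gcongr
    exact_mod_cast hBc.trans (this.trans (one_mul _).le)
  have hnet : ∀ u ∈ A, ∃ t ∈ T, hamDist u t ≤ 2 := by
    intro u hu
    obtain ⟨w, hw, huw⟩ := exists_nbr (hT u hu)
    obtain ⟨t, ht, htw⟩ := mem_finNbhd.1 hw
    have h := hamDist_triangle u w t
    rw [hamDist_of_cubeAdj huw, hamDist_of_cubeAdj (cubeAdj_comm.1 htw)] at h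
    exact ⟨t, ht, h⟩
  obtain ⟨u, hu⟩ := hne
  obtain ⟨v, hv, -⟩ := hnet u hu
  have hclose : ∀ u ∈ T ∪ T', ∃ t ∈ T, hamDist u t ≤ 6 := by
    intro u hu
    rcases mem_union.1 hu with hu | hu
    · exact ⟨u, hu, by simp [hamDist_self]⟩
    · obtain ⟨w, hw, huw⟩ := hBadj u (hTB hu)
      obtain ⟨t, ht, hwt⟩ := hnet w hw
      have h := hamDist_triangle u w t
      rw [hamDist_of_cubeAdj huw] at h
      exact ⟨t, ht, by omega⟩
  have hcardU : 2 * #(T ∪ T') ≤ n := by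
    refine hn _ ?_
    have h1 : (#(T ∪ T') : ℝ) ≤ #T + #T' := by exact_mod_cast card_union_le T T'
    have h2 : (1 - c) / 2 * d * (#(T ∪ T') : ℝ) ≤ (1 - c) / 2 * d * (#T + #T') := by gcongr
    push_cast
    linarith
  obtain ⟨L, hL1, hL2, hL3⟩ := exists_isChain_support
    (R := fun x y : Fin d → Bool => hamDist x y ≤ 6) (fun x => by simp [hamDist_self])
    (fun x y h => by rwa [hamDist_comm]) (mem_union_left T' hv)
    (fun W hW hvW => exists_crossing_of_twoLinked hlink (fun t ht => hTA ht)
      subset_union_left hnet hclose hv hW hvW) hcardU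
  refine ⟨v, hTeven v hv, L, hL1, hL2, ?_⟩
  rw [hL3]
  exact ⟨hlower, hupper, hScA, hBle⟩

open Classical in
/-- The supports of walks with `n` steps of length at most 6 which start at an even vertex. -/
noncomputable def walkSupports (d n : ℕ) : Finset (Finset (Fin d → Bool)) :=
  (univ.filter fun v => v ∈ evenV d).biUnion fun v =>
    (walksFrom (fun x y => hamDist x y ≤ 6) n v).image fun L => (v :: L).toFinset

theorem mem_walkSupports {v : Fin d → Bool} (hv : v ∈ evenV d) {L : List (Fin d → Bool)}
    (hL : (v :: L).IsChain fun x y => hamDist x y ≤ 6) :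
    (v :: L).toFinset ∈ walkSupports d L.length := by
  rw [walkSupports, mem_biUnion]
  exact ⟨v, by simpa using hv, mem_image.2 ⟨L, mem_walksFrom hL, rfl⟩⟩

theorem card_walkSupports_le (hd : 0 < d) (n : ℕ) :
    #(walkSupports d n) ≤ 2 ^ (d - 1) * (7 * d ^ 6) ^ n := by
  refine (card_biUnion_le_card_mul _ _ ((7 * d ^ 6) ^ n) fun v _ => ?_).trans
    (Nat.mul_le_mul_right _ (card_evenV_le hd))
  exact card_image_le.trans (card_walksFrom_le (card_hamDist_le hd 6) n v)

open Classical in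
theorem ncard_Hfam_le {c : ℝ} (hc0 : 0 < c) (hc1 : c < 1) (hd : 0 < d) {a g b h n : ℕ}
    (ha : a ≠ 0) (hsize : 3 * (g : ℝ) ≤ 2 ^ (c * d))
    (hn : ∀ m : ℕ, (1 - c) / 2 * d * m ≤ 4 * g → m ≤ n) :
    ((Hfam d a g b h).ncard : ℝ) ≤
      2 ^ (d - 1) * (7 * (d : ℝ) ^ 6) ^ n * 2 ^ (c * g - b) := by
  set 𝒢 := (walkSupports d n).filter fun U => lowerApprox U ⊆ upperApprox c U ∧
    (#(upperApprox c U) : ℝ) ≤ c * g ∧ b ≤ #(lowerApprox U) with h𝒢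
  have hsub : Hfam d a g b h ⊆ ((𝒢.biUnion fun U =>
      (Icc (lowerApprox U) (upperApprox c U)).image SetLike.coe) :
        Finset (Set (Fin d → Bool))) := by
    rintro A ⟨hA1, hA2, hA3, hA4, hA5, -⟩
    lift A to Finset (Fin d → Bool) using A.toFinite
    rw [← coe_finNbhd, Set.ncard_coe_finset] at hA4
    rw [Set.ncard_coe_finset] at hA3
    rw [Set.ncard_eq_toFinset_card'] at hA5
    obtain ⟨v, hv, L, hL1, hL2, hL3, hL4, hL5, hL6⟩ := exists_approx (c := c)
      (B := (bset d (A : Set (Fin d → Bool))).toFinset) hc0 hc1 hd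
      (fun u hu => hA1 hu) hA2 (card_pos.1 (by omega)) (fun v => by rw [Set.mem_toFinset]; rfl)
      (by rwa [hA4]) (n := n) (by rwa [hA4])
    rw [hA4] at hL5
    rw [hA5] at hL6
    rw [mem_coe, mem_biUnion]
    refine ⟨(v :: L).toFinset, ?_, mem_image_of_mem _ ?_⟩
    · rw [h𝒢, mem_filter]
      subst hL2
      exact ⟨mem_walkSupports hv hL1, hL3.trans hL4, hL5, hL6⟩
    · rw [mem_Icc]
      exact ⟨hL3, hL4⟩
  have h1 := Set.ncard_le_ncard hsub (finite_toSet _)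
  rw [Set.ncard_coe_finset] at h1
  calc ((Hfam d a g b h).ncard : ℝ)
      ≤ #(𝒢.biUnion fun U =>
        (Icc (lowerApprox U) (upperApprox c U)).image SetLike.coe) := by
        exact_mod_cast h1
    _ ≤ ∑ U ∈ 𝒢, (#((Icc (lowerApprox U) (upperApprox c U)).image
        SetLike.coe) : ℝ) := by exact_mod_cast card_biUnion_le
    _ ≤ ∑ U ∈ 𝒢, (2 : ℝ) ^ (c * g - b) := by
        refine sum_le_sum fun U hU => ?_
        rw [h𝒢, mem_filter] at hU
        obtain ⟨-, hle, hup, hlow⟩ := hU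
        have h2 : (#((Icc (lowerApprox U) (upperApprox c U)).image
            SetLike.coe) : ℝ) ≤
              2 ^ (#(upperApprox c U) - #(lowerApprox U)) := by
          rw [← Nat.cast_ofNat, ← Nat.cast_pow, ← card_Icc_finset hle]
          exact_mod_cast card_image_le
        refine h2.trans ?_
        rw [← Real.rpow_natCast, Nat.cast_sub (card_le_card hle)]
        refine Real.rpow_le_rpow_of_exponent_le (by norm_num) ?_
        have : (b : ℝ) ≤ #(lowerApprox U) := by exact_mod_cast hlow
        linarith
    _ = #𝒢 * (2 : ℝ) ^ (c * g - b) := by rw [sum_const, nsmul_eq_mul]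
    _ ≤ _ := by
        gcongr
        exact_mod_cast (card_filter_le _ _).trans (card_walkSupports_le hd n)

end HammingCube

end

open Filter in
theorem HammingCube.eventually_bounds {α : ℝ} (hα1 : 1 < α) {c : ℝ} (hc : Real.logb 2 α < c)
    (hc1 : c < 1) :
    ∀ᶠ d : ℕ in atTop, 2 ≤ d ∧ 3 * (d * α ^ d) ≤ (2 : ℝ) ^ (c * d) ∧
      4 * Real.logb 2 (7 * (d : ℝ) ^ 6) ≤ ((1 - c) / 2) ^ 2 * d := by
  have hα : α < 2 ^ c := (Real.logb_lt_iff_lt_rpow (by norm_num) (by linarith)).1 hc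
  have hα0 : 0 < α := by linarith
  have h1 : ∀ᶠ d : ℕ in atTop, 3 * (d * α ^ d) ≤ (2 : ℝ) ^ (c * d) := by
    have hr : 1 < (2 : ℝ) ^ c / α := (one_lt_div hα0).2 hα
    have := tendsto_pow_const_div_const_pow_of_one_lt 1 hr
    filter_upwards [this.eventually_le_const (show (0 : ℝ) < 1 / 3 by norm_num)] with d hd
    rw [pow_one, div_pow, ← Real.rpow_mul_natCast (by norm_num), div_div_eq_mul_div,
      div_le_iff₀ (by positivity)] at hd
    linarith
  have h2 : ∀ᶠ d : ℕ in atTop,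
      4 * Real.logb 2 (7 * (d : ℝ) ^ 6) ≤ ((1 - c) / 2) ^ 2 * d := by
    have hk : 0 < ((1 - c) / 2) ^ 2 * Real.log 2 / 4 / 7 := by
      have : 0 < 1 - c := by linarith
      have := Real.log_pos (show (1 : ℝ) < 2 by norm_num)
      positivity
    have hlog := (Real.isLittleO_log_id_atTop.comp_tendsto tendsto_natCast_atTop_atTop).bound hk
    filter_upwards [hlog, eventually_ge_atTop 7] with d hd hd7
    have hd7' : (7 : ℝ) ≤ d := by exact_mod_cast hd7
    have hl2 := Real.log_pos (show (1 : ℝ) < 2 by norm_num)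
    simp only [Function.comp_apply, id_eq, Real.norm_eq_abs, Nat.abs_cast] at hd
    have hd' := (le_abs_self _).trans hd
    have hle : Real.log (7 * (d : ℝ) ^ 6) ≤ 7 * Real.log d := by
      have : 7 * (d : ℝ) ^ 6 ≤ d ^ 7 := by
        rw [pow_succ' _ 6]
        gcongr
      have h := Real.log_le_log (by positivity) this
      rwa [Real.log_pow] at h
    rw [Real.logb, ← mul_div_assoc, div_le_iff₀ hl2]
    linarith
  filter_upwards [eventually_ge_atTop 2, h1, h2] with d hd h1 h2
  exact ⟨hd, h1, h2⟩

theorem main_approximation (α : ℝ) (hα1 : 1 < α) (hα2 : α < 2) :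
    ∃ ε > (0:ℝ), ∃ d₀ : ℕ, ∀ d : ℕ, d₀ ≤ d →
      ∀ a g b h : ℕ, (a:ℝ) ≤ α ^ d →
        ((Hfam d a g b h).ncard : ℝ) ≤
          (2:ℝ) ^ (d - 1) * (2:ℝ) ^ ((g:ℝ) - b - ε * g / Real.logb 2 d) := by
  have hl0 : 0 < Real.logb 2 α := Real.logb_pos (by norm_num) hα1
  have hl1 : Real.logb 2 α < 1 := by
    rw [Real.logb_lt_iff_lt_rpow (by norm_num) (by linarith)]
    simpa using hα2
  obtain ⟨c, hlc, hc1⟩ := exists_between hl1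
  have hc0 : 0 < c := hl0.trans hlc
  set κ : ℝ := (1 - c) / 2 with hκ
  have hκ0 : 0 < κ := by rw [hκ]; linarith
  obtain ⟨d₀, hd₀⟩ := Filter.eventually_atTop.1 (HammingCube.eventually_bounds hα1 hlc hc1)
  refine ⟨κ, hκ0, d₀, fun d hd a g b h ha => ?_⟩
  obtain ⟨hd2, hsize, hlog⟩ := hd₀ d hd
  rw [← hκ] at hlog
  have hdpos : 0 < d := by omega
  have hdpos' : (0 : ℝ) < d := by exact_mod_cast hdpos
  rcases (Hfam d a g b h).eq_empty_or_nonempty with hempty | ⟨A, hA⟩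
  · rw [hempty, Set.ncard_empty, Nat.cast_zero]
    positivity
  rcases eq_or_ne a 0 with rfl | ha0
  · have hAe : ∀ X ∈ Hfam d 0 g b h, X = ∅ := fun X hX => (Set.ncard_eq_zero X.toFinite).1 hX.2.2.1
    obtain rfl := hAe A hA
    have hg : g = 0 := by
      rw [← hA.2.2.2.1]
      simp [nbhd]
    have hb : b = 0 := by
      rw [← hA.2.2.2.2.1, Set.ncard_eq_zero (Set.toFinite _), Set.eq_empty_iff_forall_notMem]
      exact fun v hv => hv _ (HammingCube.cubeAdj_iff_exists_flip.2 ⟨⟨0, hdpos⟩, rfl⟩)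
    have hle : (Hfam d 0 g b h).ncard ≤ 1 :=
      (Set.ncard_le_one (Set.toFinite _)).2 fun X hX Y hY => (hAe X hX).trans (hAe Y hY).symm
    subst hg hb
    simp only [Nat.cast_zero, mul_zero, zero_div, sub_zero, Real.rpow_zero, mul_one]
    exact (by exact_mod_cast hle : ((Hfam d 0 0 0 h).ncard : ℝ) ≤ 1).trans
      (one_le_pow₀ (by norm_num))
  have hga : (g : ℝ) ≤ d * α ^ d := by
    obtain ⟨-, -, hAa, hAg, -⟩ := hA
    lift A to Finset (Fin d → Bool) using A.toFinite
    rw [← HammingCube.coe_finNbhd, Set.ncard_coe_finset] at hAg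
    rw [Set.ncard_coe_finset] at hAa
    have h1 := HammingCube.card_finNbhd_le A
    rw [hAg, hAa] at h1
    have h2 : (g : ℝ) ≤ a * d := by exact_mod_cast h1
    nlinarith
  set n := ⌊4 * (g : ℝ) / (κ * d)⌋₊ with hndef
  have hn : ∀ m : ℕ, (1 - c) / 2 * d * m ≤ 4 * g → m ≤ n := by
    intro m hm
    refine Nat.le_floor ?_
    rw [le_div_iff₀ (by positivity), mul_comm]
    exact hm
  have hcount := HammingCube.ncard_Hfam_le hc0 hc1 hdpos (b := b) (h := h) ha0
    (by linarith) hn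
  refine hcount.trans ?_
  rw [mul_assoc]
  gcongr
  have hDpos : 0 < 7 * (d : ℝ) ^ 6 := by positivity
  have hpow : (7 * (d : ℝ) ^ 6) ^ n = 2 ^ (Real.logb 2 (7 * (d : ℝ) ^ 6) * n) := by
    rw [Real.rpow_mul_natCast (by norm_num), Real.rpow_logb (by norm_num) (by norm_num) hDpos]
  rw [hpow, ← Real.rpow_add (by norm_num)]
  refine Real.rpow_le_rpow_of_exponent_le (by norm_num) ?_
  have hn' : κ * d * n ≤ 4 * g := by
    have := Nat.floor_le (show 0 ≤ 4 * (g : ℝ) / (κ * d) by positivity)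
    rw [← hndef, le_div_iff₀ (by positivity)] at this
    linarith
  have hwalk : Real.logb 2 (7 * (d : ℝ) ^ 6) * n ≤ κ * g := by
    have h1 := mul_le_mul_of_nonneg_right hlog (Nat.cast_nonneg (α := ℝ) n)
    have h2 := mul_le_mul_of_nonneg_left hn' hκ0.le
    linarith
  have hlogd : 1 ≤ Real.logb 2 d := by
    rw [Real.le_logb_iff_rpow_le (by norm_num) hdpos', Real.rpow_one]
    exact_mod_cast hd2
  have hdiv : κ * g / Real.logb 2 d ≤ κ * g := div_le_self (by positivity) hlogd
  have hκc : κ * g + c * g + κ * g = g := by rw [hκ]; ring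
  linarith
end

section
/- For every real number α with 1 < α < 2 there exist constants ε > 0 and d₀ such that for all integers d ≥ d₀ and every set A with A ⊆ E or A ⊆ O and |A| < α^d, one has |A| ≤ (1 − ε)·|N(A)|. -/
/-- `flipAt i x` is `x` with its `i`-th coordinate negated. -/
def flipAt {ι : Type*} [DecidableEq ι] (i : ι) (x : ι → Bool) : ι → Bool :=
  Function.update x i (!x i)

section flipAt

variable {ι : Type*} [DecidableEq ι]

@[simp] lemma flipAt_same (i : ι) (x : ι → Bool) : flipAt i x i = !x i := by
  simp [flipAt]

lemma flipAt_of_ne {i j : ι} (h : j ≠ i) (x : ι → Bool) : flipAt i x j = x j := by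
  simp [flipAt, h]

@[simp] lemma flipAt_flipAt (i : ι) (x : ι → Bool) : flipAt i (flipAt i x) = x := by
  simp [flipAt]

lemma flipAt_involutive (i : ι) : Function.Involutive (flipAt i) := flipAt_flipAt i

end flipAt

lemma mul_log_add_mul_log_le {a b : ℝ} (ha : 0 ≤ a) (hab : a ≤ b) :
    a * Real.log a + b * Real.log b + 2 * a * Real.log 2 ≤ (a + b) * Real.log (a + b) := by
  rcases ha.eq_or_lt with rfl | ha
  · simp
  have hb : 0 < b := ha.trans_le hab
  have h₁ : Real.log 2 + Real.log a ≤ Real.log (a + b) := by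
    rw [← Real.log_mul two_ne_zero ha.ne']
    exact Real.log_le_log (by positivity) (by linarith)
  have h₂ : a * Real.log 2 + b * Real.log b ≤ b * Real.log (a + b) := by
    have hbern : 1 + b / a * (a / b) ≤ (1 + a / b) ^ (b / a) :=
      one_add_mul_self_le_rpow_one_add (by linarith [div_pos ha hb]) ((one_le_div ha).2 hab)
    have hlog := Real.log_le_log (by positivity) hbern
    have hone : 1 + b / a * (a / b) = 2 := by field_simp; norm_num
    have hsum : 1 + a / b = (a + b) / b := by field_simp; ring
    rw [Real.log_rpow (by positivity), hone, hsum,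
      Real.log_div (by positivity) hb.ne'] at hlog
    have := mul_le_mul_of_nonneg_left hlog ha.le
    have heq : a * (b / a * (Real.log (a + b) - Real.log b)) =
        b * (Real.log (a + b) - Real.log b) := by field_simp
    linarith
  nlinarith [mul_le_mul_of_nonneg_left h₁ ha.le]

lemma min_mul_log_le {a b : ℝ} (ha : 0 ≤ a) (hb : 0 ≤ b) :
    a * Real.log a + b * Real.log b + 2 * min a b * Real.log 2 ≤
      (a + b) * Real.log (a + b) := by
  rcases le_total a b with h | h
  · simpa [min_eq_left h] using mul_log_add_mul_log_le ha h
  · have := mul_log_add_mul_log_le hb h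
    rw [min_eq_right h, add_comm a b]
    linarith

section edgeIsoperimetry

open Finset

variable {ι : Type*} [Fintype ι] [DecidableEq ι]

lemma card_filter_flipAt_split (B : Finset (ι → Bool)) (i : ι) :
    #{x ∈ B | flipAt i x ∈ B} ≤ 2 * min #{x ∈ B | x i = true} #{x ∈ B | ¬ x i = true} := by
  have hinj := (flipAt_involutive i).injective
  have hsplit := card_filter_add_card_filter_not
    (s := {x ∈ B | flipAt i x ∈ B}) (fun x => x i = true)
  have hle : ∀ (p q : (ι → Bool) → Prop) [DecidablePred p] [DecidablePred q],
      (∀ x, p x → q (flipAt i x)) →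
      #{x ∈ {x ∈ B | flipAt i x ∈ B} | p x} ≤ #{x ∈ B | q x} := by
    intro p q _ _ h
    refine card_le_card_of_injOn (flipAt i) ?_ hinj.injOn
    intro x hx
    simp only [coe_filter, mem_filter, Set.mem_ofPred_eq] at hx ⊢
    exact ⟨hx.1.2, h x hx.2⟩
  have hmono : ∀ (p : (ι → Bool) → Prop) [DecidablePred p],
      #{x ∈ {x ∈ B | flipAt i x ∈ B} | p x} ≤ #{x ∈ B | p x} := fun p _ =>
    card_le_card (filter_subset_filter _ (filter_subset _ _))
  have h₁ := hle (fun x => x i = true) (fun x => ¬ x i = true) (by simp)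
  have h₂ := hle (fun x => ¬ x i = true) (fun x => x i = true) (by simp)
  have h₃ := hmono (fun x => x i = true)
  have h₄ := hmono (fun x => ¬ x i = true)
  omega

lemma card_filter_flipAt_of_ne (B : Finset (ι → Bool)) {i j : ι} (h : i ≠ j) :
    #{x ∈ B | flipAt j x ∈ B} =
      #{x ∈ {x ∈ B | x i = true} | flipAt j x ∈ ({x ∈ B | x i = true} : Finset _)} +
      #{x ∈ {x ∈ B | ¬ x i = true} | flipAt j x ∈ ({x ∈ B | ¬ x i = true} : Finset _)} := by
  rw [← card_filter_add_card_filter_not (s := {x ∈ B | flipAt j x ∈ B}) (fun x => x i = true)]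
  congr 2 <;> ext x <;> simp only [mem_filter, flipAt_of_ne h] <;> tauto

/-- The edge-isoperimetric inequality in the cube, for edges with directions in `S`. -/
lemma sum_card_filter_flipAt_mul_log_two_le (S : Finset ι) (B : Finset (ι → Bool)) :
    (∑ j ∈ S, (#{x ∈ B | flipAt j x ∈ B} : ℝ)) * Real.log 2 ≤ #B * Real.log #B := by
  induction S using Finset.induction_on generalizing B with
  | empty => simpa using mul_nonneg (Nat.cast_nonneg _) (Real.log_natCast_nonneg _)
  | insert i S hi ih =>
    have hlog : 0 ≤ Real.log 2 := Real.log_nonneg one_le_two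
    have hcard : (#B : ℝ) = #{x ∈ B | x i = true} + #{x ∈ B | ¬ x i = true} := by
      exact_mod_cast (card_filter_add_card_filter_not (s := B) (fun x => x i = true)).symm
    have hdir : (#{x ∈ B | flipAt i x ∈ B} : ℝ) ≤
        2 * min (#{x ∈ B | x i = true} : ℝ) #{x ∈ B | ¬ x i = true} := by
      exact_mod_cast card_filter_flipAt_split B i
    have hsum := sum_congr (M := ℝ) rfl fun j hj =>
      congrArg (Nat.cast (R := ℝ)) (card_filter_flipAt_of_ne B (ne_of_mem_of_not_mem hj hi).symm)
    simp only [Nat.cast_add, sum_add_distrib] at hsum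
    rw [sum_insert hi, hsum, hcard]
    have h₁ := ih {x ∈ B | x i = true}
    have h₂ := ih {x ∈ B | ¬ x i = true}
    have h₃ := min_mul_log_le (Nat.cast_nonneg (α := ℝ) #{x ∈ B | x i = true})
      (Nat.cast_nonneg #{x ∈ B | ¬ x i = true})
    have h₄ := mul_le_mul_of_nonneg_right hdir hlog
    rw [add_mul, add_mul]
    linarith

lemma two_mul_card_filter_flipAt_le (A : Finset (ι → Bool))
    (hA : ∀ x ∈ A, ∀ i, flipAt i x ∉ A) (i j : ι) :
    2 * #{x | flipAt i x ∈ A ∧ flipAt j x ∈ A} ≤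
      #{x ∈ A ∪ A.image (flipAt i) | flipAt j x ∈ A ∪ A.image (flipAt i)} := by
  have hmem : ∀ x, x ∈ A.image (flipAt i) ↔ flipAt i x ∈ A := fun x =>
    ⟨fun h => by obtain ⟨y, hy, rfl⟩ := mem_image.1 h; simpa, fun h =>
      mem_image.2 ⟨_, h, flipAt_flipAt i x⟩⟩
  set T : Finset (ι → Bool) := {x | flipAt i x ∈ A ∧ flipAt j x ∈ A} with hT
  have hdisj : Disjoint T (T.image (flipAt j)) := by
    rw [disjoint_left]
    intro x hx hx'
    obtain ⟨y, hy, rfl⟩ := mem_image.1 hx'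
    simp only [hT, mem_filter, mem_univ, true_and, flipAt_flipAt] at hx hy
    exact hA _ hx.2 j hy.2
  have hcard : #(T ∪ T.image (flipAt j)) = 2 * #T := by
    rw [card_union_of_disjoint hdisj, card_image_of_injective _ (flipAt_involutive j).injective,
      two_mul]
  rw [← hcard]
  refine card_le_card fun x hx => ?_
  rw [mem_filter, mem_union, mem_union, hmem, hmem]
  rcases mem_union.1 hx with hx | hx
  · simp only [hT, mem_filter, mem_univ, true_and] at hx
    tauto
  · obtain ⟨y, hy, rfl⟩ := mem_image.1 hx
    simp only [hT, mem_filter, mem_univ, true_and] at hy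
    rw [flipAt_flipAt]
    tauto

lemma sum_card_filter_two_flips_mul_log_two_le (A : Finset (ι → Bool))
    (hA : ∀ x ∈ A, ∀ i, flipAt i x ∉ A) (i : ι) :
    (∑ j, (#{x | flipAt i x ∈ A ∧ flipAt j x ∈ A} : ℝ)) * Real.log 2 ≤
      #A * (Real.log 2 + Real.log #A) := by
  rcases A.eq_empty_or_nonempty with rfl | hne
  · simp
  have hdisj : Disjoint A (A.image (flipAt i)) := by
    rw [disjoint_left]
    intro x hx hx'
    obtain ⟨y, hy, rfl⟩ := mem_image.1 hx'
    exact hA y hy i hx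
  have hcard : (#(A ∪ A.image (flipAt i)) : ℝ) = 2 * #A := by
    rw [card_union_of_disjoint hdisj, card_image_of_injective _ (flipAt_involutive i).injective]
    push_cast
    ring
  have hedge := sum_card_filter_flipAt_mul_log_two_le univ (A ∪ A.image (flipAt i))
  have hpos : (0 : ℝ) < #A := by exact_mod_cast hne.card_pos
  rw [hcard, Real.log_mul two_ne_zero hpos.ne'] at hedge
  have hle : 2 * ∑ j, (#{x | flipAt i x ∈ A ∧ flipAt j x ∈ A} : ℝ) ≤
      ∑ j, (#{x ∈ A ∪ A.image (flipAt i) | flipAt j x ∈ A ∪ A.image (flipAt i)} : ℝ) := by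
    rw [mul_sum]
    exact sum_le_sum fun j _ => by exact_mod_cast two_mul_card_filter_flipAt_le A hA i j
  have := mul_le_mul_of_nonneg_right hle (Real.log_nonneg one_le_two)
  linarith

lemma card_filter_flipAt_mem (A : Finset (ι → Bool)) (i : ι) : #{x | flipAt i x ∈ A} = #A :=
  card_bij (fun x _ => flipAt i x) (by simp)
    (fun _ _ _ _ h => (flipAt_involutive i).injective h)
    (fun y hy => ⟨flipAt i y, by simpa, flipAt_flipAt i y⟩)

/-- Vertex expansion of a set with no two adjacent elements. -/
lemma card_mul_card_mul_log_two_le (A : Finset (ι → Bool))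
    (hA : ∀ x ∈ A, ∀ i, flipAt i x ∉ A) :
    (Fintype.card ι : ℝ) * #A * Real.log 2 ≤
      #{x | ∃ i, flipAt i x ∈ A} * (Real.log 2 + Real.log #A) := by
  rcases isEmpty_or_nonempty ι with hι | hι
  · simp
  rcases A.eq_empty_or_nonempty with rfl | hne
  · simp
  set N : Finset (ι → Bool) := {x | ∃ i, flipAt i x ∈ A} with hN
  have hd : (0 : ℝ) < Fintype.card ι := by exact_mod_cast Fintype.card_pos
  have hpos : (0 : ℝ) < #A := by exact_mod_cast hne.card_pos
  let g (x : ι → Bool) (i : ι) : ℝ := if flipAt i x ∈ A then 1 else 0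
  have hzero : ∀ x ∉ N, ∀ i, g x i = 0 := fun x hx i =>
    if_neg fun h => hx (by simpa [hN] using ⟨i, h⟩)
  have hdeg : ∑ x ∈ N, ∑ i, g x i = Fintype.card ι * #A := by
    rw [sum_subset (subset_univ N) fun x _ hx => sum_eq_zero fun i _ => hzero x hx i, sum_comm]
    simp [g, card_filter_flipAt_mem]
  have hsq : ∑ x ∈ N, (∑ i, g x i) ^ 2 =
      ∑ i, ∑ j, (#{x | flipAt i x ∈ A ∧ flipAt j x ∈ A} : ℝ) := by
    rw [sum_subset (subset_univ N) fun x _ hx => by simp [hzero x hx]]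
    simp_rw [sq, sum_mul_sum]
    rw [sum_comm]
    refine sum_congr rfl fun i _ => ?_
    rw [sum_comm]
    refine sum_congr rfl fun j _ => ?_
    simp [g, ← ite_and, and_comm]
  have hcs := sq_sum_le_card_mul_sum_sq (s := N) (f := fun x => ∑ i, g x i)
  rw [hdeg, hsq] at hcs
  have hpairs : (∑ i, ∑ j, (#{x | flipAt i x ∈ A ∧ flipAt j x ∈ A} : ℝ)) * Real.log 2 ≤
      Fintype.card ι * (#A * (Real.log 2 + Real.log #A)) := by
    rw [sum_mul]
    refine (sum_le_sum fun i _ =>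
      sum_card_filter_two_flips_mul_log_two_le A hA i).trans_eq ?_
    simp
  refine le_of_mul_le_mul_left ?_ (mul_pos hd hpos)
  calc (Fintype.card ι : ℝ) * #A * (Fintype.card ι * #A * Real.log 2)
      = (Fintype.card ι * #A) ^ 2 * Real.log 2 := by ring
    _ ≤ #N * (∑ i, ∑ j, (#{x | flipAt i x ∈ A ∧ flipAt j x ∈ A} : ℝ)) * Real.log 2 :=
        mul_le_mul_of_nonneg_right hcs (Real.log_nonneg one_le_two)
    _ = #N * ((∑ i, ∑ j, (#{x | flipAt i x ∈ A ∧ flipAt j x ∈ A} : ℝ)) * Real.log 2) := by ring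
    _ ≤ #N * (Fintype.card ι * (#A * (Real.log 2 + Real.log #A))) :=
        mul_le_mul_of_nonneg_left hpairs (Nat.cast_nonneg _)
    _ = Fintype.card ι * #A * (#N * (Real.log 2 + Real.log #A)) := by ring

lemma even_card_flipAt (i : ι) (x : ι → Bool) :
    Even #{k | flipAt i x k = true} ↔ ¬ Even #{k | x k = true} := by
  have hrest : ∀ y : ι → Bool, #{k | y k = true} =
      (if y i = true then 1 else 0) + #{k ∈ univ.erase i | y k = true} := by
    intro y
    rw [← insert_erase (mem_univ i), filter_insert]
    split_ifs <;> simp [add_comm]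
  have herase : #{k ∈ univ.erase i | flipAt i x k = true} = #{k ∈ univ.erase i | x k = true} :=
    congrArg card (filter_congr fun k hk => by rw [flipAt_of_ne (ne_of_mem_erase hk)])
  rw [hrest, hrest x, herase, flipAt_same]
  cases x i <;> simp [Nat.even_add, parity_simps]

end edgeIsoperimetry

lemma cubeAdj_iff_exists_flipAt {d : ℕ} {u v : Fin d → Bool} :
    cubeAdj d u v ↔ ∃ i, v = flipAt i u := by
  rw [cubeAdj, Finset.card_eq_one]
  refine exists_congr fun i => ⟨fun h => ?_, ?_⟩
  · funext k
    have hk := Finset.ext_iff.1 h k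
    simp only [Finset.mem_filter, Finset.mem_univ, true_and, Finset.mem_singleton] at hk
    by_cases hki : k = i
    · subst hki
      simpa [eq_comm, Bool.eq_not] using hk
    · rw [flipAt_of_ne hki]
      simpa [hki, eq_comm] using hk
  · rintro rfl
    ext k
    by_cases hki : k = i
    · subst hki
      simp
    · simp [flipAt_of_ne hki, hki]

lemma flipAt_notMem_of_subset {d : ℕ} {A : Set (Fin d → Bool)}
    (hA : A ⊆ evenV d ∨ A ⊆ oddV d) : ∀ x ∈ A, ∀ i, flipAt i x ∉ A := by
  intro x hx i hx'
  have := even_card_flipAt i x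
  rcases hA with hA | hA
  · exact this.1 (hA hx') (hA hx)
  · exact hA hx' (this.2 (hA hx))

theorem isoperimetry_small_sets (α : ℝ) (hα1 : 1 < α) (hα2 : α < 2) :
    ∃ ε > (0:ℝ), ∃ d₀ : ℕ, ∀ d : ℕ, d₀ ≤ d →
      ∀ A : Set (Fin d → Bool), (A ⊆ evenV d ∨ A ⊆ oddV d) →
        (A.ncard : ℝ) < α ^ d →
        (A.ncard : ℝ) ≤ (1 - ε) * (nbhd d A).ncard := by
  classical
  have hlog2 : 0 < Real.log 2 := Real.log_pos one_lt_two
  set L : ℝ := Real.log α / Real.log 2 with hL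
  have hL1 : L < 1 := (div_lt_one hlog2).2 (Real.log_lt_log (by linarith) hα2)
  have hL0 : 0 < L := div_pos (Real.log_pos hα1) hlog2
  refine ⟨(1 - L) / 2, by linarith, ⌈2 / (1 - L)⌉₊, fun d hd A hA hcard => ?_⟩
  have hd' : 2 ≤ d * (1 - L) :=
    (div_le_iff₀ (by linarith)).1 ((Nat.le_ceil _).trans (by exact_mod_cast hd))
  have hdpos : (0 : ℝ) < d := pos_of_mul_pos_left (by linarith) (by linarith : 0 ≤ 1 - L)
  have hnb : (nbhd d A).ncard = (Finset.univ.filter fun x : Fin d → Bool =>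
      ∃ i, flipAt i x ∈ A.toFinset).card := by
    rw [← Set.ncard_coe_finset]
    congr 1
    ext v
    simp only [nbhd, cubeAdj_iff_exists_flipAt, Set.mem_ofPred_eq, Finset.coe_filter,
      Finset.mem_univ, true_and, Set.mem_toFinset]
    exact ⟨fun ⟨u, hu, i, h⟩ => ⟨i, by rwa [h, flipAt_flipAt]⟩,
      fun ⟨i, h⟩ => ⟨_, h, i, (flipAt_flipAt i v).symm⟩⟩
  have key : (d : ℝ) * A.ncard * Real.log 2 ≤
      (nbhd d A).ncard * (Real.log 2 + Real.log A.ncard) := by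
    rw [hnb, Set.ncard_eq_toFinset_card']
    convert card_mul_card_mul_log_two_le A.toFinset
      (by simpa using flipAt_notMem_of_subset hA)
    simp
  rcases (Nat.cast_nonneg (α := ℝ) A.ncard).eq_or_lt with h0 | h0
  · rw [← h0]
    exact mul_nonneg (by linarith) (Nat.cast_nonneg _)
  have hlogA : Real.log A.ncard ≤ d * (L * Real.log 2) := by
    rw [hL, div_mul_cancel₀ _ hlog2.ne', ← Real.log_pow]
    exact Real.log_le_log h0 hcard.le
  have hN : (0 : ℝ) ≤ (nbhd d A).ncard := Nat.cast_nonneg _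
  refine le_of_mul_le_mul_left ?_ (mul_pos hdpos hlog2)
  calc (d : ℝ) * Real.log 2 * A.ncard = d * A.ncard * Real.log 2 := by ring
    _ ≤ (nbhd d A).ncard * (Real.log 2 + Real.log A.ncard) := key
    _ ≤ (nbhd d A).ncard * (d * (1 - L) / 2 * Real.log 2 + d * (L * Real.log 2)) := by
        gcongr
        nlinarith
    _ = d * Real.log 2 * ((1 - (1 - L) / 2) * (nbhd d A).ncard) := by ring
end

section
/- For every real number α with 1 < α < 2 there exist constants C > 0 and d₀ such that for all integers d ≥ d₀, all a ≤ α^d and all g, b, h, there exists a family U of quadruples (F,S,P,Q) with F, Q ⊆ O and S, P ⊆ E, satisfying |U| ≤ 2^{d−1}·2^{C·g·log₂ d/√d}, such that every A ∈ H(a,g,b,h) has an approximating quadruple belonging to U. -/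
/-- The number of neighbours of `u` lying in `T`. -/
noncomputable def ndeg (d : ℕ) (u : Fin d → Bool) (T : Set (Fin d → Bool)) : ℕ :=
  ({w ∈ T | cubeAdj d u w} : Set _).ncard

/-- `(F, S, P, Q)` is an approximating quadruple for `A ⊆ E`. -/
def approxQuad (d : ℕ) (A F S P Q : Set (Fin d → Bool)) : Prop :=
  F ⊆ oddV d ∧ Q ⊆ oddV d ∧ S ⊆ evenV d ∧ P ⊆ evenV d ∧
  F ⊆ nbhd d A ∧ A ⊆ S ∧
  (∀ u ∈ S, (d:ℝ) - Real.sqrt d < ndeg d u F) ∧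
  (∀ v ∈ oddV d \ F, (d:ℝ) - Real.sqrt d < ndeg d v (evenV d \ S)) ∧
  P ⊆ nbhd d (bset d A) ∧ bset d A ⊆ Q ∧
  (∀ u ∈ Q, (d:ℝ) - Real.sqrt d < ndeg d u P) ∧
  (∀ v ∈ evenV d \ P, (d:ℝ) - Real.sqrt d < ndeg d v (oddV d \ Q))

section Walks

variable {β : Type*}

/-- The walks with `n` steps starting at `v`, where `nb x` lists the possible successors of `x`. -/
def walksFrom [DecidableEq β] (nb : β → Finset β) : ℕ → β → Finset (List β)
  | 0, v => {[v]}
  | n + 1, v => (nb v).biUnion fun w => (walksFrom nb n w).image (List.cons v)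

theorem card_walksFrom_le [DecidableEq β] (nb : β → Finset β) (D : ℕ) (hD : ∀ x, (nb x).card ≤ D) (n : ℕ) (v : β) :
    (walksFrom nb n v).card ≤ D ^ n := by
  induction n generalizing v with
  | zero => simp [walksFrom]
  | succ n ih =>
    rw [walksFrom, pow_succ']
    refine (Finset.card_biUnion_le_card_mul _ _ (D ^ n) fun w _ =>
      Finset.card_image_le.trans (ih w)).trans ?_
    exact Nat.mul_le_mul_right _ (hD v)

theorem mem_walksFrom [DecidableEq β] (nb : β → Finset β) (l : List β) (v : β)
    (h : List.IsChain (fun x y => y ∈ nb x) (v :: l)) : v :: l ∈ walksFrom nb l.length v := by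
  induction l generalizing v with
  | nil => simp [walksFrom]
  | cons w l ih =>
    rw [List.isChain_cons_cons] at h
    simp only [List.length_cons, walksFrom, Finset.mem_biUnion, Finset.mem_image]
    exact ⟨w, h.1, w :: l, ih w h.2, rfl⟩

theorem exists_boundary_step {R : β → β → Prop} {s t : Finset β} {r x : β} (hr : r ∈ t)
    (hx : x ∉ t) (h : Relation.ReflTransGen (fun x y => y ∈ s ∧ R x y) r x) :
    ∃ y ∈ t, ∃ z ∈ s, z ∉ t ∧ R y z := by
  induction h with
  | refl => exact absurd hr hx
  | @tail b c _ hbc ih =>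
    by_cases hb : b ∈ t
    · exact ⟨b, hb, c, hbc.1, hx, hbc.2⟩
    · exact ih hb

theorem isChain_detour {R : β → β → Prop} (hsymm : ∀ x y, R x y → R y x) {x y : β} (hxy : R x y)
    (l₁ l₂ : List β) (h : List.IsChain R (l₁ ++ x :: l₂)) :
    List.IsChain R (l₁ ++ x :: y :: x :: l₂) := by
  rw [List.isChain_split] at h ⊢
  exact ⟨h.1, List.isChain_cons_cons.2 ⟨hxy, List.isChain_cons_cons.2 ⟨hsymm _ _ hxy, h.2⟩⟩⟩

/-- A finite set connected under a symmetric reflexive relation is traversed by a walk whose number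
of steps is any even number that is at least twice its cardinality minus two. -/
theorem exists_covering_walk [DecidableEq β] {R : β → β → Prop}
    (hsymm : ∀ x y, R x y → R y x) (hrefl : ∀ x, R x x)
    (s : Finset β) (r : β) (hr : r ∈ s)
    (hs : ∀ x ∈ s, Relation.ReflTransGen (fun x y => y ∈ s ∧ R x y) r x) (k : ℕ)
    (hk : s.card ≤ k + 1) :
    ∃ l : List β, l.length = 2 * k ∧ List.IsChain R (r :: l) ∧ (r :: l).toFinset = s := by
  have key : ∀ k : ℕ, ∃ l : List β, l.length = 2 * k ∧ List.IsChain R (r :: l) ∧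
      (r :: l).toFinset ⊆ s ∧ (k + 1 ≤ (r :: l).toFinset.card ∨ s ⊆ (r :: l).toFinset) := by
    intro k
    induction k with
    | zero => exact ⟨[], by simp, by simp, by simpa using hr, by simp⟩
    | succ k ih =>
      obtain ⟨l, hlen, hch, hsub, hor⟩ := ih
      by_cases hcov : s ⊆ (r :: l).toFinset
      · refine ⟨r :: r :: l, by simp [hlen]; omega, ?_, ?_, ?_⟩
        · exact List.isChain_cons_cons.2 ⟨hrefl _, List.isChain_cons_cons.2 ⟨hrefl _, hch⟩⟩
        · simpa using hsub
        · right; simpa using hcov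
      · obtain ⟨x, hxs, hx⟩ := Finset.not_subset.1 hcov
        obtain ⟨y, hy, z, hz, hzt, hyz⟩ := exists_boundary_step (by simp) hx (hs x hxs)
        obtain ⟨l₁, l₂, hl⟩ := List.append_of_mem (List.mem_toFinset.1 hy)
        have hch' := isChain_detour hsymm hyz l₁ l₂ (hl ▸ hch)
        have hfin : (l₁ ++ y :: z :: y :: l₂).toFinset = insert z (r :: l).toFinset := by
          rw [hl]; ext a; simp only [List.mem_toFinset, Finset.mem_insert, List.mem_append,
            List.mem_cons]; tauto
        have hlen' : (l₁ ++ y :: z :: y :: l₂).length = (r :: l).length + 2 := by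
          rw [hl]; simp; omega
        obtain ⟨l', hl'⟩ : ∃ l', l₁ ++ y :: z :: y :: l₂ = r :: l' := by
          cases l₁ with
          | nil =>
            simp only [List.nil_append, List.cons.injEq] at hl
            exact ⟨_, by rw [List.nil_append, hl.1]⟩
          | cons a l₁ =>
            simp only [List.cons_append, List.cons.injEq] at hl
            exact ⟨_, by rw [List.cons_append, hl.1]⟩
        rw [hl'] at hch' hfin hlen'
        refine ⟨l', by simp at hlen'; omega, hch', ?_, ?_⟩
        · rw [hfin]; exact Finset.insert_subset hz hsub
        · left
          rw [hfin, Finset.card_insert_of_notMem hzt]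
          have := hor.resolve_right hcov
          omega
  obtain ⟨l, hlen, hch, hsub, hor⟩ := key k
  refine ⟨l, hlen, hch, ?_⟩
  rcases hor with h | h
  · exact Finset.eq_of_subset_of_card_le hsub (by omega)
  · exact hsub.antisymm h

/-- There are few sets that are connected under a relation of bounded degree. -/
theorem exists_family_of_connected [DecidableEq β] {R : β → β → Prop} (hsymm : ∀ x y, R x y → R y x)
    (hrefl : ∀ x, R x x) (nb : β → Finset β) (hnb : ∀ x y, R x y → y ∈ nb x) (D : ℕ)
    (hD : ∀ x, (nb x).card ≤ D) (roots : Finset β) (k : ℕ) :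
    ∃ 𝓕 : Finset (Finset β), 𝓕.card ≤ roots.card * D ^ (2 * k) ∧
      ∀ s : Finset β, ∀ r ∈ roots, r ∈ s →
        (∀ x ∈ s, Relation.ReflTransGen (fun x y => y ∈ s ∧ R x y) r x) → s.card ≤ k + 1 →
          s ∈ 𝓕 := by
  refine ⟨roots.biUnion fun r => (walksFrom nb (2 * k) r).image List.toFinset, ?_, ?_⟩
  · exact Finset.card_biUnion_le_card_mul _ _ _ fun r _ =>
      Finset.card_image_le.trans (card_walksFrom_le nb D hD _ r)
  · intro s r hr hrs hs hk
    obtain ⟨l, hlen, hch, hl⟩ := exists_covering_walk hsymm hrefl s r hrs hs k hk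
    simp only [Finset.mem_biUnion, Finset.mem_image]
    refine ⟨r, hr, r :: l, ?_, hl⟩
    rw [← hlen]
    exact mem_walksFrom nb l r (hch.imp fun x y h => hnb x y h)

end Walks

section Cube

variable {d : ℕ}

theorem hamDist_comm (u v : Fin d → Bool) : hamDist u v = hamDist v u :=
  hammingDist_comm u v

theorem hamDist_triangle (u v w : Fin d → Bool) : hamDist u w ≤ hamDist u v + hamDist v w :=
  hammingDist_triangle u v w

theorem hamDist_self (u : Fin d → Bool) : hamDist u u = 0 :=
  hammingDist_self u

theorem cubeAdj.hamDist_eq {u v : Fin d → Bool} (h : cubeAdj d u v) : hamDist u v = 1 := h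

theorem cubeAdj.symm {u v : Fin d → Bool} (h : cubeAdj d u v) : cubeAdj d v u :=
  (hamDist_comm v u).trans h

theorem cubeAdj_iff_exists_update {u v : Fin d → Bool} :
    cubeAdj d u v ↔ ∃ i, v = Function.update u i (!u i) := by
  rw [cubeAdj, Finset.card_eq_one]
  refine exists_congr fun i => ⟨fun h => ?_, fun h => ?_⟩
  · funext j
    have hj := Finset.ext_iff.1 h j
    simp only [Finset.mem_filter, Finset.mem_univ, true_and, Finset.mem_singleton] at hj
    by_cases hji : j = i
    · subst hji
      have := hj.2 rfl
      simp only [Function.update_self]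
      cases hu : u j <;> cases hv : v j <;> simp_all
    · rw [Function.update_of_ne hji]
      by_contra hne
      exact hji (hj.1 fun h => hne h.symm)
  · ext j
    subst h
    by_cases hji : j = i
    · subst hji; simp
    · simp [hji]

theorem card_ball_le (v : Fin d → Bool) (k : ℕ) :
    (Finset.univ.filter fun u => hamDist v u ≤ k).card ≤ (d + 1) ^ k := by
  induction k with
  | zero =>
    rw [pow_zero, Finset.card_le_one]
    intro a ha b hb
    simp only [Finset.mem_filter, Finset.mem_univ, true_and, Nat.le_zero] at ha hb
    rw [← hammingDist_eq_zero.1 ha, ← hammingDist_eq_zero.1 hb]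
  | succ k ih =>
    have hsub : (Finset.univ.filter fun u => hamDist v u ≤ k + 1) ⊆
        (Finset.univ.filter fun u => hamDist v u ≤ k).biUnion fun u =>
          (Finset.univ : Finset (Option (Fin d))).image
            fun o => o.elim u fun i => Function.update u i (!u i) := by
      intro u hu
      simp only [Finset.mem_filter, Finset.mem_univ, true_and] at hu
      simp only [Finset.mem_biUnion, Finset.mem_filter, Finset.mem_univ, true_and,
        Finset.mem_image]
      by_cases huv : ∃ i, v i ≠ u i
      · obtain ⟨i, hi⟩ := huv
        refine ⟨Function.update u i (v i), ?_, some i, ?_⟩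
        · have hlt : hamDist v (Function.update u i (v i)) < hamDist v u := by
            refine Finset.card_lt_card (Finset.ssubset_iff_of_subset ?_ |>.2 ⟨i, by simpa, by simp⟩)
            intro j hj
            by_cases hji : j = i
            · subst hji; simp at hj
            · simpa [hji] using hj
          omega
        · funext j
          by_cases hji : j = i
          · subst hji
            cases hu : u j <;> cases hv : v j <;> simp_all
          · simp [hji]
      · push Not at huv
        refine ⟨u, ?_, none, rfl⟩
        rw [show v = u from funext huv, hamDist_self]
        exact Nat.zero_le _
    refine (Finset.card_le_card hsub).trans ?_
    rw [pow_succ]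
    refine (Finset.card_biUnion_le_card_mul _ _ (d + 1) fun u _ => ?_).trans
      (Nat.mul_le_mul_right _ ih)
    exact Finset.card_image_le.trans (by simp)

theorem ndeg_univ (u : Fin d → Bool) : ndeg d u Set.univ = d := by
  have h : {w ∈ Set.univ | cubeAdj d u w} =
      Set.range fun i => Function.update u i (!u i) := by
    ext w
    simp only [Set.mem_univ, true_and, Set.mem_ofPred_eq, Set.mem_range]
    rw [cubeAdj_iff_exists_update]
    exact exists_congr fun i => eq_comm
  rw [ndeg, h, Set.ncard_range_of_injective, Nat.card_fin]
  intro i j hij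
  by_contra hne
  have := congrFun hij i
  simp [hne] at this

theorem ndeg_mono (u : Fin d → Bool) {S T : Set (Fin d → Bool)} (h : S ⊆ T) :
    ndeg d u S ≤ ndeg d u T :=
  Set.ncard_le_ncard fun _ hw => ⟨h hw.1, hw.2⟩

theorem ndeg_add_ndeg_compl (u : Fin d → Bool) (S : Set (Fin d → Bool)) :
    ndeg d u S + ndeg d u Sᶜ = d := by
  conv_rhs => rw [← ndeg_univ u]
  rw [ndeg, ndeg, ← Set.ncard_union_eq]
  · congr 1
    ext w
    simp only [Set.mem_union, Set.mem_ofPred_eq, Set.mem_compl_iff, Set.mem_univ]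
    tauto
  · rw [Set.disjoint_left]
    exact fun w h h' => h'.1 h.1

theorem exists_adj_of_ndeg_pos {u : Fin d → Bool} {S : Set (Fin d → Bool)}
    (h : 0 < ndeg d u S) : ∃ w ∈ S, cubeAdj d u w := by
  obtain ⟨w, hw⟩ := Set.nonempty_of_ncard_ne_zero h.ne'
  exact ⟨w, hw.1, hw.2⟩

theorem exists_adj (hd : 0 < d) (u : Fin d → Bool) : ∃ w, cubeAdj d u w :=
  ⟨_, cubeAdj_iff_exists_update.2 ⟨⟨0, hd⟩, rfl⟩⟩

theorem cubeAdj.mem_oddV_iff {u v : Fin d → Bool} (h : cubeAdj d u v) :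
    v ∈ oddV d ↔ u ∈ evenV d := by
  obtain ⟨i, rfl⟩ := cubeAdj_iff_exists_update.1 h
  simp only [oddV, evenV, Set.mem_ofPred_eq]
  cases hu : u i
  · have : (Finset.univ.filter fun j => Function.update u i (!false) j = true) =
        insert i (Finset.univ.filter fun j => u j = true) := by
      ext j
      by_cases hji : j = i
      · subst hji; simp
      · simp [hji]
    rw [this, Finset.card_insert_of_notMem (by simp [hu]), Nat.even_add_one, not_not]
  · have : (Finset.univ.filter fun j => u j = true) =
        insert i (Finset.univ.filter fun j => Function.update u i (!true) j = true) := by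
      ext j
      by_cases hji : j = i
      · subst hji; simp [hu]
      · simp [hji]
    rw [this, Finset.card_insert_of_notMem (by simp), Nat.even_add_one]

theorem compl_evenV : (evenV d)ᶜ = oddV d := rfl

theorem cubeAdj.mem_evenV_iff {u v : Fin d → Bool} (h : cubeAdj d u v) :
    v ∈ evenV d ↔ u ∈ oddV d :=
  h.symm.mem_oddV_iff.symm

theorem ncard_evenV_le (hd : 0 < d) : (evenV d).ncard ≤ 2 ^ (d - 1) := by
  let f : (Fin d → Bool) → (Fin d → Bool) := fun u => Function.update u ⟨0, hd⟩ (!u ⟨0, hd⟩)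
  have hadj : ∀ u, cubeAdj d u (f u) := fun u => cubeAdj_iff_exists_update.2 ⟨_, rfl⟩
  have hf : Function.Involutive f := by
    intro u
    simp [f]
  have hle : (evenV d).ncard ≤ (evenV d)ᶜ.ncard :=
    Set.ncard_le_ncard_of_injOn f (fun u hu => (hadj u).mem_oddV_iff.2 hu) hf.injective.injOn
  have hsum := Set.ncard_add_ncard_compl (evenV d)
  rw [Nat.card_eq_fintype_card, Fintype.card_fun, Fintype.card_bool, Fintype.card_fin] at hsum
  obtain ⟨n, rfl⟩ : ∃ n, d = n + 1 := ⟨d - 1, by omega⟩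
  rw [pow_succ] at hsum
  rw [Nat.add_sub_cancel]
  omega

/-- Double counting: a set all of whose vertices have many neighbours in `T` is not much larger
than `T`. -/
theorem ncard_mul_le_of_le_ndeg (S T : Set (Fin d → Bool)) (m : ℕ)
    (h : ∀ u ∈ S, m ≤ ndeg d u T) : S.ncard * m ≤ T.ncard * d := by
  classical
  rw [Set.ncard_eq_toFinset_card' S, Set.ncard_eq_toFinset_card' T]
  refine Finset.card_mul_le_card_mul (cubeAdj d) ?_ ?_
  · intro u hu
    refine (h u (Set.mem_toFinset.1 hu)).trans (le_of_eq ?_)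
    rw [ndeg, Set.ncard_eq_toFinset_card']
    congr 1
    ext w
    simp [Finset.mem_bipartiteAbove]
  · intro w _
    refine le_trans (le_of_eq ?_) ((ndeg_mono w (Set.subset_univ S)).trans (ndeg_univ w).le)
    rw [ndeg, Set.ncard_eq_toFinset_card']
    congr 1
    ext u
    simp only [Finset.mem_bipartiteBelow, Set.mem_toFinset, Set.mem_ofPred_eq]
    exact and_congr_right fun _ => ⟨cubeAdj.symm, cubeAdj.symm⟩

theorem ncard_le_ncard_nbhd (hd : 0 < d) (A : Set (Fin d → Bool)) :
    A.ncard ≤ (nbhd d A).ncard := by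
  refine Nat.le_of_mul_le_mul_right (ncard_mul_le_of_le_ndeg A (nbhd d A) d ?_) hd
  intro u hu
  refine (ndeg_univ u).ge.trans ?_
  exact Set.ncard_le_ncard fun w hw => ⟨⟨u, hu, hw.2⟩, hw.2⟩

theorem nbhd_bset_subset (A : Set (Fin d → Bool)) : nbhd d (bset d A) ⊆ A :=
  fun _ ⟨_, hu, huv⟩ => hu _ huv

theorem nbhd_mono {A B : Set (Fin d → Bool)} (h : A ⊆ B) : nbhd d A ⊆ nbhd d B :=
  fun _ ⟨u, hu, huv⟩ => ⟨u, h hu, huv⟩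

/-- A maximal set of candidates each of which contributes at least `√d` new neighbours in `B`. -/
theorem exists_greedy (hd : 0 < d) (Z B : Set (Fin d → Bool)) :
    ∃ T ⊆ Z, (T.ncard : ℝ) * Real.sqrt d ≤ (nbhd d T ∩ B).ncard ∧
      ∀ w ∈ Z, (ndeg d w (B \ nbhd d T) : ℝ) < Real.sqrt d := by
  obtain ⟨T, ⟨hTZ, hT⟩, hmax⟩ := Set.Finite.exists_maximal
    (s := {T : Set (Fin d → Bool) | T ⊆ Z ∧ (T.ncard : ℝ) * Real.sqrt d ≤ (nbhd d T ∩ B).ncard})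
    (Set.toFinite _) ⟨∅, by simp⟩
  refine ⟨T, hTZ, hT, fun w hw => ?_⟩
  by_contra! hge
  have hdisj : Disjoint (nbhd d T ∩ B) {x ∈ B \ nbhd d T | cubeAdj d w x} := by
    rw [Set.disjoint_left]
    exact fun x hx hx' => hx'.1.2 hx.1
  have hcard : (nbhd d T ∩ B).ncard + ndeg d w (B \ nbhd d T) ≤
      (nbhd d (insert w T) ∩ B).ncard := by
    rw [ndeg, ← Set.ncard_union_eq hdisj]
    refine Set.ncard_le_ncard ?_
    rintro x (hx | hx)
    · exact ⟨nbhd_mono (Set.subset_insert w T) hx.1, hx.2⟩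
    · exact ⟨⟨w, Set.mem_insert w T, hx.2⟩, hx.1.1⟩
  have hmem : insert w T ⊆ T := by
    refine hmax ⟨Set.insert_subset hw hTZ, ?_⟩ (Set.subset_insert w T)
    have h1 : ((insert w T).ncard : ℝ) ≤ T.ncard + 1 := by exact_mod_cast Set.ncard_insert_le w T
    have h2 : ((nbhd d T ∩ B).ncard : ℝ) + ndeg d w (B \ nbhd d T) ≤
      (nbhd d (insert w T) ∩ B).ncard := by exact_mod_cast hcard
    nlinarith [Real.sqrt_nonneg (d : ℝ)]
  have hwT : w ∈ T := hmem (Set.mem_insert w T)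
  have hzero : ndeg d w (B \ nbhd d T) = 0 := by
    by_contra hne
    obtain ⟨x, hx, hwx⟩ := exists_adj_of_ndeg_pos (Nat.pos_of_ne_zero hne)
    exact hx.2 ⟨w, hwT, hwx⟩
  have hpos : 0 < Real.sqrt d := Real.sqrt_pos.2 (by exact_mod_cast hd)
  rw [hzero, Nat.cast_zero] at hge
  linarith

/-- The vertices of `X` with almost all neighbours in `N(T)`. -/
def outerApprox (d : ℕ) (X T : Set (Fin d → Bool)) : Set (Fin d → Bool) :=
  {u ∈ X | (d : ℝ) - Real.sqrt d < ndeg d u (nbhd d T)}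

/-- The outer approximation of a subset of `X` determined by its subset `T₁` and by a set `T₂` of
vertices outside of its neighbourhood. -/
def containerS (d : ℕ) (X T₁ T₂ : Set (Fin d → Bool)) : Set (Fin d → Bool) :=
  outerApprox d X T₁ \ nbhd d T₂

/-- The inner approximation of the neighbourhood of a subset of `X`, matching `containerS`. -/
def containerF (d : ℕ) (X T₁ T₂ : Set (Fin d → Bool)) : Set (Fin d → Bool) :=
  {w ∈ Xᶜ | w ∈ nbhd d T₁ ∨ Real.sqrt d ≤ ndeg d w (containerS d X T₁ T₂)}

theorem containerS_subset (X T₁ T₂ : Set (Fin d → Bool)) : containerS d X T₁ T₂ ⊆ X :=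
  fun _ hu => hu.1.1

theorem containerF_subset (X T₁ T₂ : Set (Fin d → Bool)) : containerF d X T₁ T₂ ⊆ Xᶜ :=
  fun _ hu => hu.1

theorem hamDist_le_two_of_adj {u v w : Fin d → Bool} (h₁ : cubeAdj d u v) (h₂ : cubeAdj d w v) :
    hamDist u w ≤ 2 :=
  (hamDist_triangle u v w).trans (by rw [h₁.hamDist_eq, h₂.symm.hamDist_eq])

theorem half_lt_sub_sqrt (hd : 4 ≤ d) : (d : ℝ) / 2 ≤ d - Real.sqrt d := by
  have h4 : (4 : ℝ) ≤ d := by exact_mod_cast hd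
  have hs : (2 : ℝ) ≤ Real.sqrt d := Real.le_sqrt_of_sq_le (by linarith)
  nlinarith [Real.sq_sqrt (show (0 : ℝ) ≤ d by linarith)]

/-- Every subset of one side `X` of the cube has an approximating pair determined by few vertices
close to the set. -/
theorem exists_container (hd : 4 ≤ d) (X : Set (Fin d → Bool))
    (hX : ∀ u v, cubeAdj d u v → (v ∈ Xᶜ ↔ u ∈ X)) (A : Set (Fin d → Bool)) (hA : A ⊆ X) :
    ∃ T₁ T₂ : Set (Fin d → Bool), T₁ ⊆ A ∧
      (T₁.ncard : ℝ) * Real.sqrt d ≤ (nbhd d A).ncard ∧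
      (T₂.ncard : ℝ) * Real.sqrt d ≤ 2 * (nbhd d A).ncard ∧
      (∀ u ∈ A, ∃ t ∈ T₁, hamDist t u ≤ 2) ∧ (∀ w ∈ T₂, ∃ t ∈ T₁, hamDist t w ≤ 3) ∧
      containerF d X T₁ T₂ ⊆ nbhd d A ∧ A ⊆ containerS d X T₁ T₂ ∧
      (∀ u ∈ containerS d X T₁ T₂, (d : ℝ) - Real.sqrt d < ndeg d u (containerF d X T₁ T₂)) ∧
      (∀ v ∈ Xᶜ \ containerF d X T₁ T₂,
        (d : ℝ) - Real.sqrt d < ndeg d v (X \ containerS d X T₁ T₂)) := by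
  have hhalf := half_lt_sub_sqrt hd
  have hd4 : (4 : ℝ) ≤ d := by exact_mod_cast hd
  have hsqrt : 0 < Real.sqrt d := Real.sqrt_pos.2 (by linarith)
  obtain ⟨T₁, hT₁A, hT₁, hT₁max⟩ := exists_greedy (by omega : 0 < d) A Set.univ
  have hN : nbhd d T₁ ⊆ nbhd d A := nbhd_mono hT₁A
  have hS₁near : ∀ u ∈ outerApprox d X T₁, ∃ t ∈ T₁, hamDist t u ≤ 2 := by
    intro u hu
    have hpos : (0 : ℝ) < ndeg d u (nbhd d T₁) := by linarith [hu.2]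
    obtain ⟨w, ⟨t, ht, htw⟩, huw⟩ := exists_adj_of_ndeg_pos (by exact_mod_cast hpos)
    exact ⟨t, ht, hamDist_le_two_of_adj htw huw⟩
  have hAS₁ : A ⊆ outerApprox d X T₁ := by
    intro u hu
    refine ⟨hA hu, ?_⟩
    have h := hT₁max u hu
    have hsum : (ndeg d u (nbhd d T₁) : ℝ) + ndeg d u (nbhd d T₁)ᶜ = d := by
      exact_mod_cast ndeg_add_ndeg_compl u (nbhd d T₁)
    rw [← Set.compl_eq_univ_sdiff] at h
    linarith
  have hS₁card : (outerApprox d X T₁).ncard ≤ 2 * (nbhd d A).ncard := by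
    have h := ncard_mul_le_of_le_ndeg (outerApprox d X T₁) (nbhd d T₁) ((d + 1) / 2) (by
      intro u hu
      have : (d : ℝ) < 2 * ndeg d u (nbhd d T₁) := by linarith [hu.2]
      have : d < 2 * ndeg d u (nbhd d T₁) := by exact_mod_cast this
      omega)
    have hle : (nbhd d T₁).ncard ≤ (nbhd d A).ncard := Set.ncard_le_ncard hN
    have h2 : d ≤ 2 * ((d + 1) / 2) := by omega
    refine Nat.le_of_mul_le_mul_right ?_ (show 0 < d by omega)
    nlinarith
  obtain ⟨T₂, hT₂Z, hT₂, hT₂max⟩ := exists_greedy (by omega : 0 < d)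
    ((nbhd d A)ᶜ ∩ nbhd d (outerApprox d X T₁)) (outerApprox d X T₁)
  refine ⟨T₁, T₂, hT₁A, ?_, ?_, fun u hu => hS₁near u (hAS₁ hu), ?_, ?_, ?_, ?_, ?_⟩
  · refine hT₁.trans ?_
    rw [Set.inter_univ]
    exact_mod_cast Set.ncard_le_ncard hN
  · refine hT₂.trans ?_
    exact_mod_cast (Set.ncard_le_ncard Set.inter_subset_right).trans hS₁card
  · intro w hw
    obtain ⟨u, hu, huw⟩ := (hT₂Z hw).2
    obtain ⟨t, ht, htu⟩ := hS₁near u hu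
    refine ⟨t, ht, (hamDist_triangle t u w).trans ?_⟩
    rw [huw.hamDist_eq]
    omega
  · rintro w ⟨_, hw | hw⟩
    · exact hN hw
    · by_contra hwA
      obtain ⟨u, hu, hwu⟩ := exists_adj_of_ndeg_pos (d := d) (u := w)
        (S := containerS d X T₁ T₂) (by exact_mod_cast hsqrt.trans_le hw)
      exact absurd (hT₂max w ⟨hwA, u, hu.1, hwu.symm⟩) (not_lt.2 hw)
  · intro u hu
    refine ⟨hAS₁ hu, ?_⟩
    rintro ⟨w, hw, hwu⟩
    exact (hT₂Z hw).1 ⟨u, hu, hwu.symm⟩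
  · intro u hu
    refine hu.1.2.trans_le ?_
    have : ndeg d u (nbhd d T₁) ≤ ndeg d u (containerF d X T₁ T₂) :=
      Set.ncard_le_ncard fun w hw => ⟨⟨(hX u w hw.2).2 hu.1.1, Or.inl hw.1⟩, hw.2⟩
    exact_mod_cast this
  · rintro v ⟨hvX, hvF⟩
    have hlt : (ndeg d v (containerS d X T₁ T₂) : ℝ) < Real.sqrt d := by
      by_contra! h
      exact hvF ⟨hvX, Or.inr h⟩
    have hsum : (ndeg d v (containerS d X T₁ T₂) : ℝ) + ndeg d v (containerS d X T₁ T₂)ᶜ = d := by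
      exact_mod_cast ndeg_add_ndeg_compl v (containerS d X T₁ T₂)
    have hle : ndeg d v (containerS d X T₁ T₂)ᶜ ≤ ndeg d v (X \ containerS d X T₁ T₂) :=
      Set.ncard_le_ncard fun w hw => ⟨⟨(hX w v hw.2.symm).1 hvX, hw.1⟩, hw.2⟩
    have hle' : (ndeg d v (containerS d X T₁ T₂)ᶜ : ℝ) ≤ ndeg d v (X \ containerS d X T₁ T₂) := by
      exact_mod_cast hle
    linarith


/-- The labelled vertices of `s` with label `i`. -/
def fiber (s : Finset ((Fin d → Bool) × Fin 4)) (i : Fin 4) : Set (Fin d → Bool) :=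
  {x | (x, i) ∈ s}

/-- The quadruple determined by a set of labelled vertices. -/
def containerQuad (s : Finset ((Fin d → Bool) × Fin 4)) :
    Set (Fin d → Bool) × Set (Fin d → Bool) × Set (Fin d → Bool) × Set (Fin d → Bool) :=
  (containerF d (evenV d) (fiber s 0) (fiber s 1), containerS d (evenV d) (fiber s 0) (fiber s 1),
    containerF d (oddV d) (fiber s 2) (fiber s 3), containerS d (oddV d) (fiber s 2) (fiber s 3))

theorem compl_oddV : (oddV d)ᶜ = evenV d := by
  rw [← compl_evenV, compl_compl]

theorem bset_subset_oddV (hd : 0 < d) {A : Set (Fin d → Bool)} (hA : A ⊆ evenV d) :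
    bset d A ⊆ oddV d := by
  intro v hv
  obtain ⟨w, hw⟩ := exists_adj hd v
  exact hw.mem_evenV_iff.1 (hA (hv w hw))

/-- Labelled sets dominated by a 2-linked set are connected for steps of length at most six. -/
theorem reachable_of_near {A : Set (Fin d → Bool)} (hlink : twoLinked A)
    {s : Finset ((Fin d → Bool) × Fin 4)} (h0 : fiber s 0 ⊆ A)
    (hA : ∀ u ∈ A, ∃ t ∈ fiber s 0, hamDist t u ≤ 2)
    (h1 : ∀ w ∈ fiber s 1, ∃ t ∈ fiber s 0, hamDist t w ≤ 3)
    (h2 : ∀ w ∈ fiber s 2, ∃ t ∈ fiber s 0, hamDist t w ≤ 3)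
    (h3 : ∀ w ∈ fiber s 3, ∃ t ∈ fiber s 2, hamDist t w ≤ 3)
    {r : Fin d → Bool} (hr : r ∈ fiber s 0) (p : (Fin d → Bool) × Fin 4) (hp : p ∈ s) :
    Relation.ReflTransGen (fun p q => q ∈ s ∧ hamDist p.1 q.1 ≤ 6) (r, (0 : Fin 4)) p := by
  have key : ∀ u, Relation.ReflTransGen (fun x y => y ∈ A ∧ hamDist x y ≤ 2) r u →
      u ∈ A ∧ ∀ t ∈ fiber s 0, hamDist u t ≤ 2 →
        Relation.ReflTransGen (fun p q => q ∈ s ∧ hamDist p.1 q.1 ≤ 6)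
          (r, (0 : Fin 4)) (t, (0 : Fin 4)) := by
    intro u hu
    induction hu with
    | refl => exact ⟨h0 hr, fun t ht hrt => .single ⟨ht, hrt.trans (by norm_num)⟩⟩
    | @tail b c _ hbc ih =>
      refine ⟨hbc.1, fun t ht hct => ?_⟩
      obtain ⟨t', ht', hbt'⟩ := hA b ih.1
      refine (ih.2 t' ht' (hamDist_comm b t' ▸ hbt')).tail ⟨ht, ?_⟩
      have e1 := hamDist_triangle t' b t
      have e2 := hamDist_triangle b c t
      have e3 := hbc.2
      change hamDist t' t ≤ 6
      omega
  have hz : ∀ t ∈ fiber s 0, Relation.ReflTransGen (fun p q => q ∈ s ∧ hamDist p.1 q.1 ≤ 6)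
      (r, (0 : Fin 4)) (t, (0 : Fin 4)) := fun t ht =>
    (key t (hlink r (h0 hr) t (h0 ht))).2 t ht (by rw [hamDist_self]; norm_num)
  have htwo : ∀ t ∈ fiber s 2, Relation.ReflTransGen (fun p q => q ∈ s ∧ hamDist p.1 q.1 ≤ 6)
      (r, (0 : Fin 4)) (t, (2 : Fin 4)) := by
    intro w hw
    obtain ⟨t, ht, htw⟩ := h2 w hw
    exact (hz t ht).tail ⟨hw, htw.trans (by norm_num)⟩
  obtain ⟨w, i⟩ := p
  fin_cases i
  · exact hz w hp
  · obtain ⟨t, ht, htw⟩ := h1 w hp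
    exact (hz t ht).tail ⟨hp, htw.trans (by norm_num)⟩
  · exact htwo w hp
  · obtain ⟨t, ht, htw⟩ := h3 w hp
    exact (htwo t ht).tail ⟨hp, htw.trans (by norm_num)⟩

/-- A nonempty 2-linked set of even vertices has an approximating quadruple determined by a small
connected set of labelled vertices. -/
theorem exists_connected_encoding (hd : 4 ≤ d) {A : Set (Fin d → Bool)} (hAE : A ⊆ evenV d)
    (hlink : twoLinked A) (hne : A.Nonempty) :
    ∃ s : Finset ((Fin d → Bool) × Fin 4), (s.card : ℝ) * Real.sqrt d ≤ 6 * (nbhd d A).ncard ∧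
      (∃ r ∈ evenV d, (r, (0 : Fin 4)) ∈ s ∧ ∀ p ∈ s, Relation.ReflTransGen
        (fun p q => q ∈ s ∧ hamDist p.1 q.1 ≤ 6) (r, (0 : Fin 4)) p) ∧
      approxQuad d A (containerQuad s).1 (containerQuad s).2.1 (containerQuad s).2.2.1
        (containerQuad s).2.2.2 := by
  classical
  have hd0 : 0 < d := by omega
  obtain ⟨T₁, T₂, hT₁A, hT₁, hT₂, hAT, hT₂T, hF, hS, hSF, hFS⟩ :=
    exists_container hd (evenV d) (fun u v h => h.mem_oddV_iff) A hAE
  obtain ⟨T₃, T₄, hT₃B, hT₃, hT₄, -, hT₄T, hP, hQ, hQP, hPQ⟩ :=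
    exists_container hd (oddV d) (fun u v h => by rw [compl_oddV]; exact h.mem_evenV_iff)
      (bset d A) (bset_subset_oddV hd0 hAE)
  set T : Fin 4 → Set (Fin d → Bool) := ![T₁, T₂, T₃, T₄]
  set s : Finset ((Fin d → Bool) × Fin 4) :=
    Finset.univ.biUnion fun i => (T i).toFinset ×ˢ {i} with hs
  have hfib : ∀ i, fiber s i = T i := by
    intro i
    ext x
    simp [fiber, hs]
  have e0 : fiber s 0 = T₁ := hfib 0
  have e1 : fiber s 1 = T₂ := hfib 1
  have e2 : fiber s 2 = T₃ := hfib 2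
  have e3 : fiber s 3 = T₄ := hfib 3
  refine ⟨s, ?_, ?_, ?_⟩
  · have hcard : s.card ≤ T₁.ncard + T₂.ncard + T₃.ncard + T₄.ncard := by
      calc s.card ≤ ∑ i, ((T i).toFinset ×ˢ {i}).card := Finset.card_biUnion_le
        _ = ∑ i, (T i).ncard := by
            simp only [Finset.card_product, Finset.card_singleton, mul_one,
              ← Set.ncard_eq_toFinset_card']
        _ = _ := Fin.sum_univ_four _
    have hcard' : (s.card : ℝ) ≤ T₁.ncard + T₂.ncard + T₃.ncard + T₄.ncard := by
      exact_mod_cast hcard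
    have hh : ((nbhd d (bset d A)).ncard : ℝ) ≤ (nbhd d A).ncard := by
      exact_mod_cast (Set.ncard_le_ncard (nbhd_bset_subset A)).trans (ncard_le_ncard_nbhd hd0 A)
    have := mul_le_mul_of_nonneg_right hcard' (Real.sqrt_nonneg (d : ℝ))
    linarith
  · obtain ⟨u, hu⟩ := hne
    obtain ⟨r, hr, -⟩ := hAT u hu
    have hr0 : r ∈ fiber s 0 := e0 ▸ hr
    refine ⟨r, hAE (hT₁A hr), hr0, fun p hp => ?_⟩
    refine reachable_of_near hlink ?_ ?_ ?_ ?_ ?_ hr0 p hp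
    · rwa [e0]
    · rwa [e0]
    · rwa [e0, e1]
    · rw [e0, e2]
      intro w hw
      obtain ⟨v, hv⟩ := exists_adj hd0 w
      obtain ⟨t, ht, htv⟩ := hAT v (hT₃B hw v hv)
      refine ⟨t, ht, (hamDist_triangle t v w).trans ?_⟩
      rw [hv.symm.hamDist_eq]
      omega
    · rwa [e2, e3]
  · rw [containerQuad, e0, e1, e2, e3]
    refine ⟨containerF_subset _ _ _, containerS_subset _ _ _, containerS_subset _ _ _, ?_,
      hF, hS, hSF, hFS, hP, hQ, hQP, ?_⟩
    · rw [← compl_oddV]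
      exact containerF_subset _ _ _
    · rwa [compl_oddV] at hPQ

theorem approxQuad_empty (hd : 0 < d) : approxQuad d ∅ ∅ ∅ ∅ ∅ := by
  have hpos : 0 < Real.sqrt d := Real.sqrt_pos.2 (by exact_mod_cast hd)
  have hb : bset d ∅ ⊆ ∅ := by
    intro v hv
    obtain ⟨w, hw⟩ := exists_adj hd v
    exact hv w hw
  have hdeg : ∀ (v : Fin d → Bool) (S : Set (Fin d → Bool)), (∀ w, cubeAdj d v w → w ∈ S) →
      (d : ℝ) - Real.sqrt d < ndeg d v S := by
    intro v S h
    have : d ≤ ndeg d v S :=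
      (ndeg_univ v).ge.trans (Set.ncard_le_ncard fun w hw => ⟨h w hw.2, hw.2⟩)
    have : (d : ℝ) ≤ ndeg d v S := by exact_mod_cast this
    linarith
  refine ⟨Set.empty_subset _, Set.empty_subset _, Set.empty_subset _, Set.empty_subset _,
    Set.empty_subset _, Set.empty_subset _, by simp, ?_, Set.empty_subset _, hb, by simp, ?_⟩
  · exact fun v hv => hdeg v _ fun w hw => ⟨hw.mem_evenV_iff.2 hv.1, Set.notMem_empty w⟩
  · exact fun v hv => hdeg v _ fun w hw => ⟨hw.mem_oddV_iff.2 hv.1, Set.notMem_empty w⟩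

theorem pow_floor_le_rpow (hd : 4 ≤ d) (g : ℕ) :
    (((d + 1) ^ 6 * 4 : ℕ) : ℝ) ^ (2 * ⌊6 * (g : ℝ) / Real.sqrt d⌋₊) ≤
      (2 : ℝ) ^ (156 * g * Real.logb 2 d / Real.sqrt d) := by
  have hd4 : (4 : ℝ) ≤ d := by exact_mod_cast hd
  set M := ⌊6 * (g : ℝ) / Real.sqrt d⌋₊
  have hM : (M : ℝ) ≤ 6 * g / Real.sqrt d := Nat.floor_le (by positivity)
  have hlog : 0 ≤ Real.logb 2 d := Real.logb_nonneg (by norm_num) (by linarith)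
  have hbase : (((d + 1) ^ 6 * 4 : ℕ) : ℝ) ≤ (d : ℝ) ^ 13 := by
    push_cast
    calc ((d : ℝ) + 1) ^ 6 * 4 ≤ ((d : ℝ) ^ 2) ^ 6 * d := by
          gcongr
          nlinarith
      _ = (d : ℝ) ^ 13 := by ring
  calc (((d + 1) ^ 6 * 4 : ℕ) : ℝ) ^ (2 * M) ≤ ((d : ℝ) ^ 13) ^ (2 * M) := by gcongr
    _ = (d : ℝ) ^ (26 * M) := by rw [← pow_mul]; congr 1; ring
    _ = ((2 : ℝ) ^ Real.logb 2 d) ^ (26 * M) := by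
        rw [Real.rpow_logb (by norm_num) (by norm_num) (by linarith)]
    _ = (2 : ℝ) ^ (Real.logb 2 d * (26 * M)) := by
        rw [← Real.rpow_natCast, ← Real.rpow_mul (by norm_num)]
        push_cast
        rfl
    _ ≤ _ := by
        refine Real.rpow_le_rpow_of_exponent_le (by norm_num) ?_
        calc Real.logb 2 d * (26 * M) ≤ Real.logb 2 d * (26 * (6 * g / Real.sqrt d)) := by gcongr
          _ = 156 * g * Real.logb 2 d / Real.sqrt d := by ring

end Cube

theorem approximating_family (α : ℝ) (hα1 : 1 < α) (hα2 : α < 2) :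
    ∃ C > (0:ℝ), ∃ d₀ : ℕ, ∀ d : ℕ, d₀ ≤ d →
      ∀ a g b h : ℕ, (a:ℝ) ≤ α ^ d →
        ∃ U : Set (Set (Fin d → Bool) × Set (Fin d → Bool) ×
                   Set (Fin d → Bool) × Set (Fin d → Bool)),
          (∀ q ∈ U, q.1 ⊆ oddV d ∧ q.2.1 ⊆ evenV d ∧ q.2.2.1 ⊆ evenV d ∧
            q.2.2.2 ⊆ oddV d) ∧
          (U.ncard : ℝ) ≤ (2:ℝ) ^ (d - 1) * (2:ℝ) ^ (C * g * Real.logb 2 d / Real.sqrt d) ∧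
          ∀ A ∈ Hfam d a g b h, ∃ q ∈ U, approxQuad d A q.1 q.2.1 q.2.2.1 q.2.2.2 := by
  classical
  refine ⟨156, by norm_num, 4, fun d hd a g b h _ => ?_⟩
  have hd0 : 0 < d := by omega
  have hsqrt : 0 < Real.sqrt d := Real.sqrt_pos.2 (by exact_mod_cast hd0)
  rcases Nat.eq_zero_or_pos g with rfl | hg
  · refine ⟨{(∅, ∅, ∅, ∅)}, by simp, ?_, ?_⟩
    · simpa using one_le_pow₀ (M₀ := ℝ) one_le_two
    · rintro A ⟨-, -, -, hA, -⟩
      have hA0 : A.ncard = 0 := Nat.le_zero.1 (hA ▸ ncard_le_ncard_nbhd hd0 A)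
      rw [Set.ncard_eq_zero] at hA0
      subst hA0
      exact ⟨_, rfl, approxQuad_empty hd0⟩
  obtain ⟨𝓕, hcard, h𝓕⟩ := exists_family_of_connected
    (R := fun p q : (Fin d → Bool) × Fin 4 => hamDist p.1 q.1 ≤ 6)
    (fun p q h => hamDist_comm p.1 q.1 ▸ h) (fun p => by simp [hamDist_self])
    (fun p => (Finset.univ.filter fun u => hamDist p.1 u ≤ 6) ×ˢ Finset.univ)
    (fun p q h => by simpa using h) ((d + 1) ^ 6 * 4)
    (fun p => by
      rw [Finset.card_product, Finset.card_univ, Fintype.card_fin]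
      exact Nat.mul_le_mul_right _ (card_ball_le _ _))
    ((evenV d).toFinset ×ˢ {0}) ⌊6 * (g : ℝ) / Real.sqrt d⌋₊
  refine ⟨containerQuad '' 𝓕, ?_, ?_, ?_⟩
  · rintro _ ⟨s, -, rfl⟩
    exact ⟨containerF_subset _ _ _, containerS_subset _ _ _,
      (containerF_subset _ _ _).trans compl_oddV.subset, containerS_subset _ _ _⟩
  · rw [Finset.card_product, Finset.card_singleton, mul_one, ← Set.ncard_eq_toFinset_card'] at hcard
    have hle : (containerQuad '' (𝓕 : Set (Finset ((Fin d → Bool) × Fin 4)))).ncard ≤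
        2 ^ (d - 1) * ((d + 1) ^ 6 * 4) ^ (2 * ⌊6 * (g : ℝ) / Real.sqrt d⌋₊) := by
      refine (Set.ncard_image_le 𝓕.finite_toSet).trans ?_
      rw [Set.ncard_coe_finset]
      exact hcard.trans (Nat.mul_le_mul_right _ (ncard_evenV_le hd0))
    calc ((containerQuad '' (𝓕 : Set (Finset ((Fin d → Bool) × Fin 4)))).ncard : ℝ)
        ≤ 2 ^ (d - 1) * (((d + 1) ^ 6 * 4 : ℕ) : ℝ) ^ (2 * ⌊6 * (g : ℝ) / Real.sqrt d⌋₊) := by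
          exact_mod_cast hle
      _ ≤ _ := by
          gcongr
          exact pow_floor_le_rpow hd g
  · rintro A ⟨hAE, hlink, -, hA, -⟩
    have hne : A.Nonempty := by
      rw [Set.nonempty_iff_ne_empty]
      rintro rfl
      simp [nbhd] at hA
      omega
    obtain ⟨s, hs, ⟨r, hrE, hrs, hconn⟩, happrox⟩ := exists_connected_encoding hd hAE hlink hne
    refine ⟨containerQuad s, ⟨s, ?_, rfl⟩, happrox⟩
    refine h𝓕 s (r, 0) (by simpa using hrE) hrs hconn ?_
    rw [hA, ← le_div_iff₀ hsqrt] at hs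
    exact (Nat.le_floor hs).trans (Nat.le_succ _)
end
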